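/- Let Z_1 and Z_2 be centered Gaussian random vectors in R^p (p ≥ 2) with covariance matrices Σ¹ and Σ², respectively, where Σ²_{jj} ≥ c for all j = 1,…,p and some constant c > 0. Then sup_{y ∈ R^p} |P(Z_1 ≤ y) − P(Z_2 ≤ y)| ≤ C (Δ log² p)^{1/2}, where Δ = max_{1≤j,k≤p} |Σ¹_{jk} − Σ²_{jk}| and C is a constant depending only on c. -/

import Mathlib

open MeasureTheory ProbabilityTheory

/-- `G` is a centered Gaussian random vector in `ℝ^p` with covariance matrix `S`. -/
def IsCenteredGaussianVec {Ω : Type} [MeasurableSpace Ω] (μ : Measure Ω) {p : ℕ}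
    (G : Ω → Fin p → ℝ) (S : Fin p → Fin p → ℝ) : Prop :=
  ∀ u : Fin p → ℝ,
    Measure.map (fun ω => ∑ j, u j * G ω j) μ =
      gaussianReal 0 (Real.toNNReal (∑ j, ∑ k, u j * S j k * u k))

lemma hasDerivAt_gaussianPDFReal_zero {v : NNReal} (hv : v ≠ 0) (x : ℝ) :
    HasDerivAt (gaussianPDFReal 0 v) (-(x / v) * gaussianPDFReal 0 v x) x := by
  have hv' : (v : ℝ) ≠ 0 := by exact_mod_cast hv
  have h : HasDerivAt (fun x : ℝ => -(x - 0) ^ 2 / (2 * (v : ℝ))) (-(x / v)) x := by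
    have := ((((hasDerivAt_id x).sub_const 0).pow 2).neg).div_const (2 * (v : ℝ))
    convert! this using 1
    simp
    field_simp
  have := (h.exp).const_mul (√(2 * Real.pi * v))⁻¹
  convert! this using 1
  simp only [gaussianPDFReal]
  ring

/-- Stein's identity for a centered real Gaussian. -/
lemma integral_id_mul_gaussianReal {v : NNReal} (hv : v ≠ 0) {F F' : ℝ → ℝ} {B : ℝ}
    (hF : ∀ x, HasDerivAt F (F' x) x) (hF' : Measurable F')
    (hB : ∀ x, |F x| ≤ B) (hB' : ∀ x, |F' x| ≤ B) :
    ∫ x, x * F x ∂(gaussianReal 0 v) = v * ∫ x, F' x ∂(gaussianReal 0 v) := by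
  have hv' : (v : ℝ) ≠ 0 := by exact_mod_cast hv
  have hFc : Continuous F := continuous_iff_continuousAt.2 fun x => (hF x).continuousAt
  have hpdf := integrable_gaussianPDFReal 0 v
  have hid : Integrable (fun x => x * gaussianPDFReal 0 v x) := by
    have h1 : Integrable (fun x : ℝ => x) (gaussianReal 0 v) :=
      memLp_one_iff_integrable.1 (memLp_id_gaussianReal' 1 (by simp))
    rw [gaussianReal_of_var_ne_zero _ hv, integrable_withDensity_iff_integrable_smul'
      (measurable_gaussianPDF 0 v) (by simp [gaussianPDF])] at h1
    simpa [toReal_gaussianPDF, mul_comm] using h1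
  rw [integral_gaussianReal_eq_integral_smul hv, integral_gaussianReal_eq_integral_smul hv]
  simp only [smul_eq_mul]
  have key := integral_mul_deriv_eq_deriv_mul_of_integrable (u := F) (u' := F')
    (v := gaussianPDFReal 0 v) (v' := fun x => -(x / v) * gaussianPDFReal 0 v x)
    (fun x _ => hF x) (fun x _ => hasDerivAt_gaussianPDFReal_zero hv x) ?_ ?_ ?_
  · have e1 : ∀ x, gaussianPDFReal 0 v x * (x * F x) =
        -v * (F x * (-(x / v) * gaussianPDFReal 0 v x)) := by
      intro x; field_simp
    simp_rw [e1]
    rw [integral_const_mul, key, ← integral_neg, ← integral_const_mul, ← integral_const_mul]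
    congr 1; ext x; ring
  · have : Integrable (fun x => F x * ((x * gaussianPDFReal 0 v x))) :=
      hid.bdd_mul hFc.aestronglyMeasurable (.of_forall hB)
    convert! this.const_mul (-(v : ℝ)⁻¹) using 1
    ext x
    simp only [Pi.mul_apply]
    ring
  · exact hpdf.bdd_mul hF'.aestronglyMeasurable (.of_forall hB')
  · exact hpdf.bdd_mul hFc.aestronglyMeasurable (.of_forall hB)

section Decomposition

variable {Ω ι : Type*} [MeasurableSpace Ω] [Fintype ι] {μ : Measure Ω} {Y : Ω → ℝ} {Z : Ω → ι → ℝ}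

/-- The residual of the linear regression of a Gaussian vector on a jointly Gaussian variable is
independent of that variable. -/
lemma ProbabilityTheory.HasGaussianLaw.indepFun_residual
    (h : HasGaussianLaw (fun ω => (Y ω, Z ω)) μ) (hY : Var[Y; μ] ≠ 0) :
    IndepFun Y (fun ω i => Z ω i - cov[Y, fun ω => Z ω i; μ] / Var[Y; μ] * Y ω) μ := by
  have := h.isProbabilityMeasure
  set b : ι → ℝ := fun i => cov[Y, fun ω => Z ω i; μ] / Var[Y; μ] with hb
  have hYm : MemLp Y 2 μ := h.fst.memLp_two
  have hZm : ∀ i, MemLp (fun ω => Z ω i) 2 μ := fun i =>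
    (HasGaussianLaw.eval (X := fun i ω => Z ω i) h.snd i).memLp_two
  let L : ℝ × (ι → ℝ) →L[ℝ] (Unit → ℝ) × (ι → ℝ) :=
    (ContinuousLinearMap.pi fun _ => ContinuousLinearMap.fst ℝ ℝ (ι → ℝ)).prod
      (ContinuousLinearMap.pi fun i =>
        (ContinuousLinearMap.proj i).comp (ContinuousLinearMap.snd ℝ ℝ (ι → ℝ)) -
          b i • ContinuousLinearMap.fst ℝ ℝ (ι → ℝ))
  have hL := h.map_fun L
  have key := HasGaussianLaw.indepFun_of_covariance_eval (X := fun (_ : Unit) ω => Y ω)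
    (Y := fun i ω => Z ω i - b i * Y ω) (P := μ) (by simpa [L] using! hL) ?_
  · exact key.comp (φ := fun u : Unit → ℝ => u ()) (ψ := id) (by fun_prop) (by fun_prop)
  · intro _ i
    have : cov[Y, (fun ω => Z ω i) - (fun ω => b i * Y ω); μ] = 0 := by
      rw [covariance_sub_right hYm (hZm i) (hYm.const_mul _), covariance_const_mul_right,
        covariance_self hYm.aemeasurable]
      simp only [hb]
      field_simp
      ring
    exact this

/-- Gaussian integration by parts. -/
lemma ProbabilityTheory.HasGaussianLaw.integral_mul_comp_eq_sum_cov
    (h : HasGaussianLaw (fun ω => (Y ω, Z ω)) μ) (hY0 : μ[Y] = 0)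
    {f : (ι → ℝ) → ℝ} {f' : ι → (ι → ℝ) → ℝ} {B : ℝ}
    (hf : ∀ z, HasFDerivAt f (∑ k, f' k z • ContinuousLinearMap.proj (R := ℝ) (φ := fun _ : ι => ℝ) k) z)
    (hf' : ∀ k, Continuous (f' k)) (hB : ∀ z, |f z| ≤ B) (hB' : ∀ k z, |f' k z| ≤ B) :
    ∫ ω, Y ω * f (Z ω) ∂μ = ∑ k, cov[Y, fun ω => Z ω k; μ] * ∫ ω, f' k (Z ω) ∂μ := by
  have := h.isProbabilityMeasure
  have hYm : MemLp Y 2 μ := h.fst.memLp_two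
  have hYa : AEMeasurable Y μ := h.fst.aemeasurable
  have hZa : AEMeasurable Z μ := h.snd.aemeasurable
  have hfc : Continuous f := continuous_iff_continuousAt.2 fun z => (hf z).continuousAt
  by_cases hv : Var[Y; μ] = 0
  · have hY : Y =ᵐ[μ] fun _ => 0 := by
      have h1 : evariance Y μ = 0 := by
        rw [← hYm.ofReal_variance_eq, hv, ENNReal.ofReal_zero]
      have h2 := (evariance_eq_zero_iff hYa).1 h1
      simpa [hY0] using! h2
    have hc : ∀ k, cov[Y, fun ω => Z ω k; μ] = 0 := by
      intro k
      simp only [covariance, hY0]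
      apply integral_eq_zero_of_ae
      filter_upwards [hY] with ω hω
      simp [hω]
    simp only [hc, zero_mul, Finset.sum_const_zero]
    apply integral_eq_zero_of_ae
    filter_upwards [hY] with ω hω
    simp [hω]
  · set b : ι → ℝ := fun i => cov[Y, fun ω => Z ω i; μ] / Var[Y; μ] with hb
    set V : Ω → ι → ℝ := fun ω i => Z ω i - b i * Y ω with hV
    have hind : IndepFun Y V μ := h.indepFun_residual hv
    have hVa : AEMeasurable V μ := by fun_prop
    set v : NNReal := Var[Y; μ].toNNReal with hvdef
    have hvv : (v : ℝ) = Var[Y; μ] := Real.coe_toNNReal _ (variance_nonneg _ _)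
    have hv0 : v ≠ 0 := fun h0 => hv (by rw [← hvv, h0]; rfl)
    have hlaw : μ.map Y = gaussianReal 0 v := by
      rw [h.fst.map_eq_gaussianReal, hY0]
    have hprod : μ.map (fun ω => (Y ω, V ω)) = (gaussianReal 0 v).prod (μ.map V) := by
      rw [← hlaw]; exact (indepFun_iff_map_prod_eq_prod_map_map hYa hVa).1 hind
    have hZV : ∀ ω, Z ω = V ω + Y ω • b := by
      intro ω; ext i; simp [hV, mul_comm]
    have : IsProbabilityMeasure (μ.map V) := Measure.isProbabilityMeasure_map hVa
    have fub : ∀ g : ℝ → (ι → ℝ) → ℝ, Continuous (Function.uncurry g) →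
        Integrable (Function.uncurry g) ((gaussianReal 0 v).prod (μ.map V)) →
        ∫ ω, g (Y ω) (V ω) ∂μ = ∫ w, ∫ y, g y w ∂(gaussianReal 0 v) ∂(μ.map V) := by
      intro g hg hi
      have h1 := integral_prod_symm _ hi
      rw [← hprod, integral_map (by fun_prop) hg.aestronglyMeasurable] at h1
      exact h1
    have bdd : ∀ g : (ι → ℝ) → ℝ, Continuous g → (∀ z, |g z| ≤ B) →
        Integrable (fun q : ℝ × (ι → ℝ) => g (q.2 + q.1 • b))
          ((gaussianReal 0 v).prod (μ.map V)) := by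
      intro g hg hgB
      refine Integrable.of_bound (C := B) (by fun_prop) (.of_forall fun q => hgB _)
    have hiY : Integrable (fun q : ℝ × (ι → ℝ) => q.1) ((gaussianReal 0 v).prod (μ.map V)) := by
      have : Integrable (fun x : ℝ => x) (gaussianReal 0 v) :=
        memLp_one_iff_integrable.1 (memLp_id_gaussianReal' 1 (by simp))
      exact this.comp_fst _
    simp_rw [hZV]
    rw [fub (fun y w => y * f (w + y • b)) (by unfold Function.uncurry; fun_prop)
      (by
        have := hiY.bdd_mul (c := B) (f := fun q : ℝ × (ι → ℝ) => f (q.2 + q.1 • b))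
          (by fun_prop) (.of_forall fun q => hB _)
        simpa only [mul_comm] using! this)]
    have st : ∀ w, ∫ y, y * f (w + y • b) ∂(gaussianReal 0 v) =
        v * ∫ y, ∑ k, b k * f' k (w + y • b) ∂(gaussianReal 0 v) := by
      intro w
      refine integral_id_mul_gaussianReal (B := B + ∑ k, |b k| * B) hv0 (fun y => ?_)
        (by fun_prop) (fun y => ?_) (fun y => ?_)
      · have h1 : HasDerivAt (fun y : ℝ => w + y • b) b y := by
          simpa using ((hasDerivAt_id y).smul_const b).const_add w
        have := (hf (w + y • b)).comp_hasDerivAt y h1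
        simpa [mul_comm] using! this
      · have h0 : 0 ≤ B := (abs_nonneg _).trans (hB 0)
        exact (hB _).trans (le_add_of_nonneg_right
          (Finset.sum_nonneg fun k _ => mul_nonneg (abs_nonneg _) h0))
      · have h0 : 0 ≤ B := (abs_nonneg _).trans (hB 0)
        refine (Finset.abs_sum_le_sum_abs _ _).trans ?_
        refine (Finset.sum_le_sum fun k _ => ?_).trans (le_add_of_nonneg_left h0)
        rw [abs_mul]
        exact mul_le_mul_of_nonneg_left (hB' _ _) (abs_nonneg _)
    simp_rw [st]
    rw [integral_const_mul, ← fub (fun y w => ∑ k, b k * f' k (w + y • b))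
      (by unfold Function.uncurry; fun_prop)
      (by
        unfold Function.uncurry
        exact integrable_finsetSum _ fun k _ => (bdd _ (hf' k) (hB' k)).const_mul _)]
    rw [integral_finsetSum]
    · rw [Finset.mul_sum]
      refine Finset.sum_congr rfl fun k _ => ?_
      rw [integral_const_mul, ← mul_assoc]
      congr 1
      simp only [← hZV]
      rw [hvv, hb]
      field_simp
    · intro k _
      refine Integrable.const_mul ?_ _
      exact Integrable.of_bound (C := B) ((hf' k).comp_aestronglyMeasurable (by fun_prop))
        (.of_forall fun q => hB' _ _)

end Decomposition

section Interpolation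

variable {Ω ι : Type*} [MeasurableSpace Ω] [Fintype ι] [Nonempty ι] {μ : Measure Ω} {X Y : Ω → ι → ℝ}

/-- Gaussian interpolation: comparison of smooth functionals of two uncorrelated centered Gaussian
vectors through the integrated second derivatives along the rotation between them. -/
lemma ProbabilityTheory.HasGaussianLaw.abs_integral_sub_le_of_interpolation
    (h : HasGaussianLaw (fun ω => (X ω, Y ω)) μ)
    (hX0 : ∀ j, μ[fun ω => X ω j] = 0) (hY0 : ∀ j, μ[fun ω => Y ω j] = 0)
    (hXY : ∀ j k, cov[fun ω => X ω j, fun ω => Y ω k; μ] = 0)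
    {Δ : ℝ} (hΔ : ∀ j k, |cov[fun ω => X ω j, fun ω => X ω k; μ] -
      cov[fun ω => Y ω j, fun ω => Y ω k; μ]| ≤ Δ)
    {m : (ι → ℝ) → ℝ} {m₁ : ι → (ι → ℝ) → ℝ} {m₂ : ι → ι → (ι → ℝ) → ℝ} {B M : ℝ}
    (hm : ∀ z, HasFDerivAt m
      (∑ k, m₁ k z • ContinuousLinearMap.proj (R := ℝ) (φ := fun _ : ι => ℝ) k) z)
    (hm₁ : ∀ j z, HasFDerivAt (m₁ j)
      (∑ k, m₂ j k z • ContinuousLinearMap.proj (R := ℝ) (φ := fun _ : ι => ℝ) k) z)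
    (hm₂ : ∀ j k, Continuous (m₂ j k))
    (hB : ∀ z, |m z| ≤ B) (hB₁ : ∀ j z, |m₁ j z| ≤ B) (hB₂ : ∀ j k z, |m₂ j k z| ≤ B)
    (hM : ∀ θ : ℝ, ∑ j, ∑ k, ∫ ω, |m₂ j k (Real.sin θ • X ω + Real.cos θ • Y ω)| ∂μ ≤ M) :
    |∫ ω, m (X ω) ∂μ - ∫ ω, m (Y ω) ∂μ| ≤ 2 * (Δ * M) := by
  have := h.isProbabilityMeasure
  have hXm : ∀ i, MemLp (fun ω => X ω i) 2 μ := fun i =>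
    (HasGaussianLaw.eval (X := fun i ω => X ω i) h.fst i).memLp_two
  have hYm : ∀ i, MemLp (fun ω => Y ω i) 2 μ := fun i =>
    (HasGaussianLaw.eval (X := fun i ω => Y ω i) h.snd i).memLp_two
  have hXi : ∀ i, Integrable (fun ω => X ω i) μ := fun i => (hXm i).integrable (by simp)
  have hYi : ∀ i, Integrable (fun ω => Y ω i) μ := fun i => (hYm i).integrable (by simp)
  have hXa : AEMeasurable X μ := h.fst.aemeasurable
  have hYa : AEMeasurable Y μ := h.snd.aemeasurable
  have hmc : Continuous m := continuous_iff_continuousAt.2 fun z => (hm z).continuousAt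
  have hm₁c : ∀ j, Continuous (m₁ j) := fun j =>
    continuous_iff_continuousAt.2 fun z => (hm₁ j z).continuousAt
  set Z : ℝ → Ω → ι → ℝ := fun θ ω => Real.sin θ • X ω + Real.cos θ • Y ω with hZ
  set D : ℝ → Ω → ι → ℝ := fun θ ω => Real.cos θ • X ω - Real.sin θ • Y ω with hD
  have hZa : ∀ θ, AEMeasurable (Z θ) μ := fun θ => by fun_prop
  have hDa : ∀ θ, AEMeasurable (D θ) μ := fun θ => by fun_prop
  have hDi : ∀ θ j, Integrable (fun ω => D θ ω j) μ := fun θ j =>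
    ((hXi j).const_mul _).sub ((hYi j).const_mul _)
  have hDmi : ∀ θ j, Integrable (fun ω => D θ ω j * m₁ j (Z θ ω)) μ := fun θ j => by
    have := (hDi θ j).bdd_mul (c := B) (f := fun ω => m₁ j (Z θ ω))
      ((hm₁c j).comp_aestronglyMeasurable (hZa θ).aestronglyMeasurable) (.of_forall fun q => hB₁ _ _)
    simpa only [mul_comm] using! this
  have hderiv : ∀ θ, HasDerivAt (fun θ => ∫ ω, m (Z θ ω) ∂μ)
      (∫ ω, ∑ j, D θ ω j * m₁ j (Z θ ω) ∂μ) θ := by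
    intro θ
    refine (hasDerivAt_integral_of_dominated_loc_of_deriv_le (s := Set.univ)
      (F := fun θ ω => m (Z θ ω)) (F' := fun θ ω => ∑ j, D θ ω j * m₁ j (Z θ ω))
      (bound := fun ω => ∑ j, (|X ω j| + |Y ω j|) * B) Filter.univ_mem
      (.of_forall fun θ => hmc.comp_aestronglyMeasurable (hZa θ).aestronglyMeasurable)
      ?_ ?_ ?_ ?_ ?_).2
    · exact Integrable.of_bound (C := B)
        (hmc.comp_aestronglyMeasurable (hZa θ).aestronglyMeasurable) (.of_forall fun ω => hB _)
    · exact (integrable_finsetSum _ fun j _ => hDmi θ j).aestronglyMeasurable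
    · refine .of_forall fun ω θ _ => ?_
      refine (Finset.abs_sum_le_sum_abs _ _).trans (Finset.sum_le_sum fun j _ => ?_)
      rw [abs_mul]
      refine mul_le_mul ?_ (hB₁ _ _) (abs_nonneg _) (by positivity)
      refine (abs_sub _ _).trans (add_le_add ?_ ?_)
      · simp only [Pi.smul_apply, smul_eq_mul, abs_mul]
        exact mul_le_of_le_one_left (abs_nonneg _) (Real.abs_cos_le_one _)
      · simp only [Pi.smul_apply, smul_eq_mul, abs_mul]
        exact mul_le_of_le_one_left (abs_nonneg _) (Real.abs_sin_le_one _)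
    · exact integrable_finsetSum _ fun j _ => ((hXi j).abs.add (hYi j).abs).mul_const _
    · refine .of_forall fun ω θ _ => ?_
      have h1 : HasDerivAt (fun θ => Z θ ω) (D θ ω) θ := by
        have := ((Real.hasDerivAt_sin θ).smul_const (X ω)).add
          ((Real.hasDerivAt_cos θ).smul_const (Y ω))
        convert! this using 1
        simp [hD, sub_eq_add_neg]
      have := (hm (Z θ ω)).comp_hasDerivAt θ h1
      simpa [mul_comm] using! this
  have hcov : ∀ θ j k, cov[fun ω => D θ ω j, fun ω => Z θ ω k; μ] = Real.sin θ * Real.cos θ *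
      (cov[fun ω => X ω j, fun ω => X ω k; μ] - cov[fun ω => Y ω j, fun ω => Y ω k; μ]) := by
    intro θ j k
    have e1 : (fun ω => D θ ω j) =
      (fun ω => Real.cos θ * X ω j) - (fun ω => Real.sin θ * Y ω j) := by ext; simp [hD]
    have e2 : (fun ω => Z θ ω k) =
      (fun ω => Real.sin θ * X ω k) + (fun ω => Real.cos θ * Y ω k) := by ext; simp [hZ]
    rw [e1, e2, covariance_sub_left ((hXm j).const_mul _) ((hYm j).const_mul _)
      (((hXm k).const_mul _).add ((hYm k).const_mul _)),
      covariance_add_right ((hXm j).const_mul _) ((hXm k).const_mul _) ((hYm k).const_mul _),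
      covariance_add_right ((hYm j).const_mul _) ((hXm k).const_mul _) ((hYm k).const_mul _)]
    simp only [covariance_const_mul_left, covariance_const_mul_right, hXY,
      covariance_comm (fun ω => Y ω j) (fun ω => X ω k)]
    ring
  have hbound : ∀ θ, |∫ ω, ∑ j, D θ ω j * m₁ j (Z θ ω) ∂μ| ≤ Δ * M := by
    intro θ
    rw [integral_finsetSum _ fun j _ => hDmi θ j]
    have hibp : ∀ j, ∫ ω, D θ ω j * m₁ j (Z θ ω) ∂μ =
        ∑ k, cov[fun ω => D θ ω j, fun ω => Z θ ω k; μ] * ∫ ω, m₂ j k (Z θ ω) ∂μ := by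
      intro j
      let L : (ι → ℝ) × (ι → ℝ) →L[ℝ] ℝ × (ι → ℝ) :=
        ((ContinuousLinearMap.proj j).comp (Real.cos θ • ContinuousLinearMap.fst ℝ (ι → ℝ) (ι → ℝ)
          - Real.sin θ • ContinuousLinearMap.snd ℝ (ι → ℝ) (ι → ℝ))).prod
        (Real.sin θ • ContinuousLinearMap.fst ℝ (ι → ℝ) (ι → ℝ)
          + Real.cos θ • ContinuousLinearMap.snd ℝ (ι → ℝ) (ι → ℝ))
      have hL : HasGaussianLaw (fun ω => (D θ ω j, Z θ ω)) μ := h.map_fun L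
      refine hL.integral_mul_comp_eq_sum_cov ?_ (hm₁ j) (hm₂ j) (hB₁ j) (hB₂ j)
      simp only [hD, Pi.sub_apply, Pi.smul_apply, smul_eq_mul]
      rw [integral_sub ((hXi j).const_mul _) ((hYi j).const_mul _), integral_const_mul,
        integral_const_mul, hX0, hY0]
      simp
    have hΔM : ∀ j k, |cov[fun ω => D θ ω j, fun ω => Z θ ω k; μ] * ∫ ω, m₂ j k (Z θ ω) ∂μ| ≤
        Δ * ∫ ω, |m₂ j k (Z θ ω)| ∂μ := by
      intro j k
      have h0 : 0 ≤ Δ := (abs_nonneg _).trans (hΔ j k)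
      rw [abs_mul]
      refine mul_le_mul ?_ (abs_integral_le_integral_abs) (abs_nonneg _) h0
      rw [hcov, abs_mul, abs_mul]
      calc _ ≤ 1 * 1 * Δ := by
            gcongr
            · exact Real.abs_sin_le_one _
            · exact Real.abs_cos_le_one _
            · exact hΔ j k
        _ = Δ := by ring
    obtain ⟨i⟩ := ‹Nonempty ι›
    have h0 : 0 ≤ Δ := (abs_nonneg _).trans (hΔ i i)
    calc _ ≤ ∑ j, ∑ k, Δ * ∫ ω, |m₂ j k (Z θ ω)| ∂μ := by
          refine (Finset.abs_sum_le_sum_abs _ _).trans (Finset.sum_le_sum fun j _ => ?_)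
          rw [hibp]
          exact (Finset.abs_sum_le_sum_abs _ _).trans (Finset.sum_le_sum fun k _ => hΔM j k)
      _ = Δ * ∑ j, ∑ k, ∫ ω, |m₂ j k (Z θ ω)| ∂μ := by simp only [Finset.mul_sum]
      _ ≤ _ := mul_le_mul_of_nonneg_left (hM θ) h0
  have hfin := convex_univ.norm_image_sub_le_of_norm_hasDerivWithin_le
    (fun θ _ => (hderiv θ).hasDerivWithinAt) (fun θ _ => hbound θ) (Set.mem_univ 0)
    (Set.mem_univ (Real.pi / 2))
  have h0 : 0 ≤ Δ * M := (abs_nonneg _).trans (hbound 0)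
  simp only [hZ, Real.sin_pi_div_two, Real.cos_pi_div_two, Real.sin_zero, Real.cos_zero, one_smul,
    zero_smul, add_zero, zero_add, sub_zero, Real.norm_eq_abs] at hfin
  refine hfin.trans ?_
  rw [abs_of_pos (by positivity), mul_comm]
  exact mul_le_mul_of_nonneg_right (by linarith [Real.pi_le_four]) h0

end Interpolation

lemma gaussianReal_le_of_shift {A A' : Set ℝ} {s T : ℝ} (hA : MeasurableSet A)
    (hA' : MeasurableSet A') (hs : 0 ≤ s) (hT : ∀ x ∈ A, x ≤ T) (hAA' : ∀ x ∈ A, x + s ∈ A') :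
    gaussianReal 0 1 A ≤ ENNReal.ofReal (Real.exp (T * s + s ^ 2 / 2)) * gaussianReal 0 1 A' := by
  rw [gaussianReal_apply _ one_ne_zero, gaussianReal_apply _ one_ne_zero,
    ← lintegral_indicator hA, ← lintegral_indicator hA',
    ← lintegral_add_right_eq_self (A'.indicator _) s,
    ← lintegral_const_mul' _ _ ENNReal.ofReal_ne_top]
  refine lintegral_mono fun x => ?_
  by_cases hx : x ∈ A
  · simp only [hx, hAA' x hx, Set.indicator_of_mem, gaussianPDF, gaussianPDFReal]
    rw [← ENNReal.ofReal_mul (Real.exp_nonneg _), mul_left_comm, ← Real.exp_add]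
    refine ENNReal.ofReal_le_ofReal (mul_le_mul_of_nonneg_left (Real.exp_le_exp.2 ?_)
      (by positivity))
    have := mul_le_mul_of_nonneg_right (hT x hx) hs
    simp only [NNReal.coe_one]
    nlinarith
  · simp [hx]

section Nazarov

variable {Ω : Type*} [MeasurableSpace Ω] {μ : Measure Ω} {p : ℕ}

/-- The set of vectors `x` for which `x - y` has its first maximal coordinate at `j`, with value in
the `i`-th interval of length `ε`. -/
def argmaxCell (y : Fin p → ℝ) (ε : ℝ) (j : Fin p) (i : ℕ) : Set (Fin p → ℝ) :=
  {x | (i * ε < x j - y j ∧ x j - y j ≤ (i + 1) * ε) ∧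
    (∀ k, k < j → x k - y k < x j - y j) ∧ ∀ k, x k - y k ≤ x j - y j}

lemma measurableSet_argmaxCell (y : Fin p → ℝ) (ε : ℝ) (j : Fin p) (i : ℕ) :
    MeasurableSet (argmaxCell y ε j i) := by
  unfold argmaxCell
  measurability

lemma pairwise_disjoint_argmaxCell (y : Fin p → ℝ) {ε : ℝ} (hε : 0 < ε) :
    Pairwise (Function.onFun Disjoint fun q : Fin p × ℕ => argmaxCell y ε q.1 q.2) := by
  rintro ⟨j, i⟩ ⟨j', i'⟩ hne
  refine Set.disjoint_left.2 ?_
  rintro x ⟨⟨h1, h2⟩, h3, h4⟩ ⟨⟨h1', h2'⟩, h3', h4'⟩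
  simp only at *
  have hj : j = j' := by
    rcases lt_trichotomy j j' with h | h | h
    · exact absurd (h3' _ h) (not_lt.2 (h4 _))
    · exact h
    · exact absurd (h3 _ h) (not_lt.2 (h4' _))
  subst hj
  have a1 : (i : ℝ) < i' + 1 := lt_of_mul_lt_mul_right (h1.trans_le h2') hε.le
  have a2 : (i' : ℝ) < i + 1 := lt_of_mul_lt_mul_right (h1'.trans_le h2) hε.le
  have : i = i' := by
    have b1 : i < i' + 1 := by exact_mod_cast a1
    have b2 : i' < i + 1 := by exact_mod_cast a2
    omega
  exact hne (by rw [this])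

lemma exists_mem_argmaxCell {x y : Fin p → ℝ} {ε : ℝ} (h : ∀ j, x j ≤ y j + ε)
    (h' : ¬ ∀ j, x j ≤ y j) : ∃ j, x ∈ argmaxCell y ε j 0 := by
  classical
  push Not at h'
  obtain ⟨j₀, hj₀⟩ := h'
  obtain ⟨j₁, -, hj₁⟩ := Finset.exists_max_image Finset.univ (fun k => x k - y k) ⟨j₀, by simp⟩
  set A : Finset (Fin p) := Finset.univ.filter fun j => ∀ k, x k - y k ≤ x j - y j with hA
  have hne : A.Nonempty := ⟨j₁, by simpa [hA] using hj₁⟩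
  have hmem : ∀ k, x k - y k ≤ x (A.min' hne) - y (A.min' hne) := by
    have := A.min'_mem hne
    simpa [hA] using this
  refine ⟨A.min' hne, ⟨⟨?_, ?_⟩, ?_, hmem⟩⟩
  · have := hmem j₀
    push_cast
    linarith
  · have := h (A.min' hne)
    push_cast
    linarith
  · intro k hk
    refine lt_of_le_of_ne (hmem k) fun heq => ?_
    have hkA : k ∈ A := by
      simp only [hA, Finset.mem_filter, Finset.mem_univ, true_and]
      intro l
      rw [heq]
      exact hmem l
    exact absurd (A.min'_le k hkA) (not_le.2 hk)

variable {X : Ω → Fin p → ℝ}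

lemma ProbabilityTheory.HasGaussianLaw.measureReal_argmaxCell_zero_le
    (h : HasGaussianLaw X μ) (hX : Measurable X) (h0 : ∀ j, μ[fun ω => X ω j] = 0)
    (h1 : ∀ j, Var[fun ω => X ω j; μ] = 1) {y : Fin p → ℝ} {a ε : ℝ} (ha : 1 ≤ a)
    (hε : 0 < ε) (hεa : ε ≤ 1 / a) {j : Fin p} (hj : y j ≤ a) {i : ℕ} (hi : i * ε ≤ 1 / a) :
    μ.real (X ⁻¹' argmaxCell y ε j 0) ≤ Real.exp (5 / 2) * μ.real (X ⁻¹' argmaxCell y ε j i) := by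
  have := h.isProbabilityMeasure
  have hXm : ∀ i, MemLp (fun ω => X ω i) 2 μ := fun i =>
    (HasGaussianLaw.eval (X := fun i ω => X ω i) h i).memLp_two
  let L : (Fin p → ℝ) →L[ℝ] ℝ × (Fin p → ℝ) :=
    (ContinuousLinearMap.proj j).prod (ContinuousLinearMap.id ℝ _)
  have hL : HasGaussianLaw (fun ω => (X ω j, X ω)) μ := h.map_fun L
  set b : Fin p → ℝ := fun k => cov[fun ω => X ω j, fun ω => X ω k; μ] /
    Var[fun ω => X ω j; μ] with hb
  have hb1 : ∀ k, b k ≤ 1 := by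
    intro k
    have := variance_nonneg ((fun ω => X ω j) - fun ω => X ω k) μ
    rw [variance_sub (hXm j) (hXm k), h1, h1] at this
    simp only [hb, h1, div_one]
    linarith
  set V : Ω → Fin p → ℝ := fun ω i => X ω i - b i * X ω j with hV
  have hind : IndepFun (fun ω => X ω j) V μ := hL.indepFun_residual (by rw [h1]; exact one_ne_zero)
  have hVm : Measurable V := by fun_prop
  have hlaw : μ.map (fun ω => X ω j) = gaussianReal 0 1 := by
    rw [hL.fst.map_eq_gaussianReal, h0, h1, Real.toNNReal_one]
  have hprod : μ.map (fun ω => (X ω j, V ω)) = (gaussianReal 0 1).prod (μ.map V) := by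
    rw [← hlaw]
    exact (indepFun_iff_map_prod_eq_prod_map_map (by fun_prop) (by fun_prop)).1 hind
  have : IsProbabilityMeasure (μ.map V) := Measure.isProbabilityMeasure_map (by fun_prop)
  let S : ℕ → Set (ℝ × (Fin p → ℝ)) := fun i =>
    {q | (i * ε < q.1 - y j ∧ q.1 - y j ≤ (i + 1) * ε) ∧
      (∀ k, k < j → q.2 k + b k * q.1 - y k < q.1 - y j) ∧
      ∀ k, q.2 k + b k * q.1 - y k ≤ q.1 - y j}
  have hS : ∀ i, MeasurableSet (S i) := by
    intro i
    simp only [S]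
    measurability
  have hμ : ∀ i, μ (X ⁻¹' argmaxCell y ε j i) =
      ∫⁻ v, gaussianReal 0 1 ((fun x => (x, v)) ⁻¹' S i) ∂(μ.map V) := by
    intro i
    rw [← Measure.prod_apply_symm (hS i), ← hprod, Measure.map_apply (by fun_prop) (hS i)]
    congr 1
    ext ω
    simp [argmaxCell, S, hV]
  have hle : μ (X ⁻¹' argmaxCell y ε j 0) ≤
      ENNReal.ofReal (Real.exp (5 / 2)) * μ (X ⁻¹' argmaxCell y ε j i) := by
    rw [hμ, hμ, ← lintegral_const_mul' _ _ ENNReal.ofReal_ne_top]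
    refine lintegral_mono fun v => ?_
    have hiε : 0 ≤ i * ε := by positivity
    refine (gaussianReal_le_of_shift (A := (fun x => (x, v)) ⁻¹' S 0)
      (A' := (fun x => (x, v)) ⁻¹' S i) (s := i * ε) (T := a + 1 / a)
      (measurable_prodMk_right (hS 0)) (measurable_prodMk_right (hS i)) hiε ?_ ?_).trans ?_
    · rintro x ⟨⟨-, hx⟩, -⟩
      push_cast at hx
      linarith
    · rintro x ⟨⟨hx1, hx2⟩, hx3, hx4⟩
      simp only [CharP.cast_eq_zero, zero_mul, zero_add, one_mul] at hx1 hx2 hx3 hx4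
      have hbi : ∀ k, b k * (i * ε) ≤ i * ε := fun k => mul_le_of_le_one_left hiε (hb1 k)
      refine ⟨⟨?_, ?_⟩, ?_, ?_⟩
      · simp only; linarith
      · simp only; linarith
      · intro k hk
        have := hx3 k hk
        have := hbi k
        simp only; linarith
      · intro k
        have := hx4 k
        have := hbi k
        simp only; linarith
    · gcongr
      have ha0 : 0 < a := by linarith
      have e1 : a * (1 / a) = 1 := by field_simp
      have e2 : 1 / a ≤ 1 := by rw [div_le_one ha0]; exact ha
      have e3 : 0 < 1 / a := by positivity
      have t1 : (a + 1 / a) * (i * ε) ≤ (a + 1 / a) * (1 / a) :=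
        mul_le_mul_of_nonneg_left hi (by positivity)
      nlinarith
  have := ENNReal.toReal_mono (by finiteness) hle
  rwa [ENNReal.toReal_mul, ENNReal.toReal_ofReal (Real.exp_nonneg _)] at this

lemma gaussianReal_real_Ioc_le {y ε a : ℝ} (ha : 0 ≤ a) (hay : a ≤ y) (hε : 0 < ε) :
    (gaussianReal 0 1).real (Set.Ioc y (y + ε)) ≤ ε * Real.exp (-a ^ 2 / 2) := by
  rw [measureReal_def, gaussianReal_apply _ one_ne_zero]
  refine ENNReal.toReal_le_of_le_ofReal (by positivity) ?_
  calc ∫⁻ x in Set.Ioc y (y + ε), gaussianPDF 0 1 x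
      ≤ ∫⁻ x in Set.Ioc y (y + ε), ENNReal.ofReal (Real.exp (-a ^ 2 / 2)) := by
        refine setLIntegral_mono (by fun_prop) fun x hx => ENNReal.ofReal_le_ofReal ?_
        rw [gaussianPDFReal]
        have h1 : (√(2 * Real.pi * (1 : NNReal)))⁻¹ ≤ 1 := by
          refine inv_le_one_of_one_le₀ ?_
          rw [Real.one_le_sqrt]
          simp only [NNReal.coe_one]
          linarith [Real.pi_gt_three]
        refine (mul_le_of_le_one_left (Real.exp_nonneg _) h1).trans (Real.exp_le_exp.2 ?_)
        have : a < x := hay.trans_lt hx.1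
        simp only [NNReal.coe_one]
        nlinarith
    _ = _ := by
        rw [setLIntegral_const, Real.volume_Ioc, mul_comm, add_sub_cancel_left,
          ← ENNReal.ofReal_mul hε.le]

/-- Nazarov's anti-concentration inequality, for unit variances. -/
lemma ProbabilityTheory.HasGaussianLaw.measureReal_le_add_of_var_eq_one (hp : 2 ≤ p)
    (h : HasGaussianLaw X μ) (hX : Measurable X) (h0 : ∀ j, μ[fun ω => X ω j] = 0)
    (h1 : ∀ j, Var[fun ω => X ω j; μ] = 1) (y : Fin p → ℝ) {ε : ℝ} (hε : 0 < ε) :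
    μ.real {ω | ∀ j, X ω j ≤ y j + ε} ≤ μ.real {ω | ∀ j, X ω j ≤ y j} +
      (1 + Real.exp (5 / 2)) * √2 * √(Real.log p) * ε := by
  have := h.isProbabilityMeasure
  set a : ℝ := √(2 * Real.log p) with ha
  have hlog : 0 < Real.log p := Real.log_pos (by exact_mod_cast hp)
  have ha1 : 1 ≤ a := by
    rw [ha, Real.one_le_sqrt]
    have : Real.log 2 ≤ Real.log p := Real.log_le_log (by norm_num) (by exact_mod_cast hp)
    linarith [Real.log_two_gt_d9]
  have ha2 : a ^ 2 = 2 * Real.log p := Real.sq_sqrt (by positivity)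
  have haeq : √2 * √(Real.log p) = a := (Real.sqrt_mul (by norm_num) _).symm
  rw [mul_assoc (1 + _), haeq]
  set κ : ℝ := Real.exp (5 / 2) with hκ
  have hκ0 : 0 < κ := Real.exp_pos _
  by_cases hεa : ε ≤ 1 / a
  swap
  · have h2 : 1 ≤ a * ε := by
      rw [not_le, div_lt_iff₀ (by linarith)] at hεa
      linarith
    calc μ.real {ω | ∀ j, X ω j ≤ y j + ε} ≤ 1 := measureReal_le_one
      _ ≤ a * ε := h2
      _ ≤ (1 + κ) * (a * ε) := le_mul_of_one_le_left (by positivity) (by linarith)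
      _ ≤ _ := by
        rw [mul_assoc]
        exact le_add_of_nonneg_left measureReal_nonneg
  classical
  set J : Finset (Fin p) := Finset.univ.filter fun j => y j ≤ a with hJ
  set E : Fin p → ℕ → Set Ω := fun j i => X ⁻¹' argmaxCell y ε j i with hE
  have hEm : ∀ j i, MeasurableSet (E j i) := fun j i => hX (measurableSet_argmaxCell y ε j i)
  set N : ℕ := ⌈1 / (a * ε)⌉₊ with hN
  have haε : 0 < a * ε := by positivity
  have hNle : 1 / (a * ε) ≤ N := Nat.le_ceil _
  have hJsum : ∑ j ∈ J, μ.real (E j 0) ≤ κ * (a * ε) := by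
    have hdis : ∑ q ∈ J ×ˢ Finset.range N, μ.real (E q.1 q.2) ≤ 1 := by
      rw [← measureReal_biUnion_finset (f := fun q : Fin p × ℕ => E q.1 q.2)]
      · exact measureReal_le_one
      · intro q _ q' _ hne
        exact (pairwise_disjoint_argmaxCell y hε hne).preimage X
      · exact fun q _ => hEm _ _
    rw [Finset.sum_product] at hdis
    have hN' : N * ∑ j ∈ J, μ.real (E j 0) ≤ κ := by
      calc N * ∑ j ∈ J, μ.real (E j 0) = ∑ j ∈ J, ∑ i ∈ Finset.range N, μ.real (E j 0) := by
            simp [Finset.mul_sum]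
        _ ≤ ∑ j ∈ J, ∑ i ∈ Finset.range N, κ * μ.real (E j i) := by
            refine Finset.sum_le_sum fun j hj => Finset.sum_le_sum fun i hi => ?_
            refine h.measureReal_argmaxCell_zero_le hX h0 h1 ha1 hε hεa (by simpa [hJ] using hj) ?_
            have : (i : ℝ) < 1 / (a * ε) := Nat.lt_ceil.1 (Finset.mem_range.1 hi)
            rw [lt_div_iff₀ haε] at this
            rw [le_div_iff₀ (by linarith)]
            linarith
        _ = κ * ∑ j ∈ J, ∑ i ∈ Finset.range N, μ.real (E j i) := by simp only [Finset.mul_sum]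
        _ ≤ κ * 1 := mul_le_mul_of_nonneg_left hdis hκ0.le
        _ = κ := mul_one _
    have hnn : 0 ≤ ∑ j ∈ J, μ.real (E j 0) := Finset.sum_nonneg fun _ _ => measureReal_nonneg
    have h3 := (mul_le_mul_of_nonneg_right hNle hnn).trans hN'
    rw [one_div_mul_eq_div, div_le_iff₀ haε] at h3
    exact h3
  have hJc : ∑ j ∈ Finset.univ.filter (fun j => ¬ y j ≤ a), μ.real (E j 0) ≤ ε := by
    calc _ ≤ ∑ j ∈ Finset.univ.filter (fun j => ¬ y j ≤ a), ε * Real.exp (-a ^ 2 / 2) := by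
          refine Finset.sum_le_sum fun j hj => ?_
          have hlaw : μ.map (fun ω => X ω j) = gaussianReal 0 1 := by
            rw [(HasGaussianLaw.eval (X := fun i ω => X ω i) h j).map_eq_gaussianReal, h0, h1,
              Real.toNNReal_one]
          have hay : a ≤ y j := by
            simp only [Finset.mem_filter, not_le] at hj
            exact hj.2.le
          refine le_trans ?_ (gaussianReal_real_Ioc_le (by linarith) hay hε)
          rw [← hlaw, map_measureReal_apply (by fun_prop) measurableSet_Ioc]
          refine measureReal_mono ?_
          rintro ω ⟨⟨h2, h3⟩, -⟩
          simp only [CharP.cast_eq_zero, zero_mul, zero_add, one_mul] at h2 h3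
          exact ⟨by linarith, by linarith⟩
      _ ≤ ∑ j : Fin p, ε * Real.exp (-a ^ 2 / 2) :=
          Finset.sum_le_sum_of_subset_of_nonneg (Finset.filter_subset _ _)
            fun _ _ _ => by positivity
      _ = ε := by
          have : -a ^ 2 / 2 = -Real.log p := by rw [ha2]; ring
          have hp0 : (0 : ℝ) < p := by positivity
          rw [this, Real.exp_neg, Real.exp_log hp0]
          simp
          field_simp
  calc μ.real {ω | ∀ j, X ω j ≤ y j + ε}
      ≤ μ.real ({ω | ∀ j, X ω j ≤ y j} ∪ ⋃ j, E j 0) := by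
        refine measureReal_mono fun ω hω => ?_
        by_cases hω' : ∀ j, X ω j ≤ y j
        · exact Or.inl hω'
        · obtain ⟨j, hj⟩ := exists_mem_argmaxCell hω hω'
          exact Or.inr (Set.mem_iUnion.2 ⟨j, hj⟩)
    _ ≤ μ.real {ω | ∀ j, X ω j ≤ y j} + ∑ j, μ.real (E j 0) :=
        (measureReal_union_le _ _).trans (add_le_add le_rfl (measureReal_iUnion_fintype_le _))
    _ = μ.real {ω | ∀ j, X ω j ≤ y j} + (∑ j ∈ J, μ.real (E j 0) +
          ∑ j ∈ Finset.univ.filter (fun j => ¬ y j ≤ a), μ.real (E j 0)) := by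
        rw [Finset.sum_filter_add_sum_filter_not]
    _ ≤ μ.real {ω | ∀ j, X ω j ≤ y j} + (κ * (a * ε) + ε) := by gcongr
    _ ≤ _ := by nlinarith

/-- Nazarov's anti-concentration inequality. -/
lemma ProbabilityTheory.HasGaussianLaw.measureReal_le_add (hp : 2 ≤ p)
    (h : HasGaussianLaw X μ) (hX : Measurable X) (h0 : ∀ j, μ[fun ω => X ω j] = 0)
    {c : ℝ} (hc : 0 < c) (hv : ∀ j, c ≤ Var[fun ω => X ω j; μ]) (y : Fin p → ℝ) {ε : ℝ}
    (hε : 0 < ε) :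
    μ.real {ω | ∀ j, X ω j ≤ y j + ε} ≤ μ.real {ω | ∀ j, X ω j ≤ y j} +
      (1 + Real.exp (5 / 2)) * √2 / √c * √(Real.log p) * ε := by
  have := h.isProbabilityMeasure
  set σ : Fin p → ℝ := fun j => √(Var[fun ω => X ω j; μ]) with hσ
  have hσc : ∀ j, √c ≤ σ j := fun j => Real.sqrt_le_sqrt (hv j)
  have hc0 : 0 < √c := Real.sqrt_pos.2 hc
  have hσ0 : ∀ j, 0 < σ j := fun j => hc0.trans_le (hσc j)
  set W : Ω → Fin p → ℝ := fun ω j => (σ j)⁻¹ * X ω j with hW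
  let L : (Fin p → ℝ) →L[ℝ] (Fin p → ℝ) :=
    ContinuousLinearMap.pi fun j => (σ j)⁻¹ • ContinuousLinearMap.proj j
  have hWG : HasGaussianLaw W μ := h.map_fun L
  have hW0 : ∀ j, μ[fun ω => W ω j] = 0 := fun j => by
    simp only [hW, integral_const_mul, h0, mul_zero]
  have hW1 : ∀ j, Var[fun ω => W ω j; μ] = 1 := fun j => by
    simp only [hW, variance_const_mul]
    have : Var[fun ω => X ω j; μ] = σ j ^ 2 := (Real.sq_sqrt (variance_nonneg _ _)).symm
    rw [this]
    have := (hσ0 j).ne'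
    field_simp
  have key := hWG.measureReal_le_add_of_var_eq_one hp (by fun_prop) hW0 hW1
    (fun j => (σ j)⁻¹ * y j) (ε := ε / √c) (by positivity)
  have e1 : {ω | ∀ j, W ω j ≤ (σ j)⁻¹ * y j} = {ω | ∀ j, X ω j ≤ y j} := by
    ext ω
    simp only [hW, Set.mem_ofPred_eq]
    exact forall_congr' fun j => mul_le_mul_iff_right₀ (inv_pos.2 (hσ0 j))
  rw [e1] at key
  calc _ ≤ μ.real {ω | ∀ j, W ω j ≤ (σ j)⁻¹ * y j + ε / √c} := by
        refine measureReal_mono fun ω hω j => ?_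
        simp only [hW]
        calc (σ j)⁻¹ * X ω j ≤ (σ j)⁻¹ * (y j + ε) :=
              mul_le_mul_of_nonneg_left (hω j) (inv_pos.2 (hσ0 j)).le
          _ = (σ j)⁻¹ * y j + ε / σ j := by ring
          _ ≤ _ := by
            have := hσc j
            gcongr
    _ ≤ _ := key
    _ = _ := by ring

end Nazarov

section SoftMax

variable {Ω : Type*} [MeasurableSpace Ω] {μ : Measure Ω} {p : ℕ}

/-- The sum of the exponentials of the coordinates of `β • (z - y)`. -/
noncomputable def sumExp (β : ℝ) (y z : Fin p → ℝ) : ℝ := ∑ j, Real.exp (β * (z j - y j))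

lemma sumExp_nonneg (β : ℝ) (y z : Fin p → ℝ) : 0 ≤ sumExp β y z :=
  Finset.sum_nonneg fun _ _ => (Real.exp_pos _).le

lemma continuous_sumExp (β : ℝ) (y : Fin p → ℝ) : Continuous (sumExp β y) := by
  unfold sumExp
  fun_prop

lemma sumExp_add_log_two_div {β : ℝ} (hβ : 0 < β) (y z : Fin p → ℝ) :
    sumExp β (fun j => y j + Real.log 2 / β) z = sumExp β y z / 2 := by
  simp only [sumExp, Finset.sum_div]
  refine Finset.sum_congr rfl fun j _ => ?_
  have : β * (z j - (y j + Real.log 2 / β)) = β * (z j - y j) - Real.log 2 := by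
    field_simp
    ring
  rw [this, Real.exp_sub, Real.exp_log two_pos]

lemma lintegral_exp_neg_sumExp [SFinite μ] {X : Ω → Fin p → ℝ} (hX : Measurable X)
    (β : ℝ) (y : Fin p → ℝ) :
    ∫⁻ ω, ENNReal.ofReal (Real.exp (-sumExp β y (X ω))) ∂μ =
      ∫⁻ u, μ {ω | ∀ j, 0 < u j ∧ u j ≤ Real.exp (-Real.exp (β * (X ω j - y j)))}
        ∂(Measure.pi fun _ : Fin p => (volume : Measure ℝ).restrict (Set.Ioo 0 1)) := by
  set ν := Measure.pi fun _ : Fin p => (volume : Measure ℝ).restrict (Set.Ioo 0 1) with hν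
  let A : Set (Ω × (Fin p → ℝ)) :=
    {q | ∀ j, 0 < q.2 j ∧ q.2 j ≤ Real.exp (-Real.exp (β * (X q.1 j - y j)))}
  have hA : MeasurableSet A := by
    have : A = ⋂ j, {q : Ω × (Fin p → ℝ) | 0 < q.2 j} ∩
        {q | q.2 j ≤ Real.exp (-Real.exp (β * (X q.1 j - y j)))} := by
      ext q; simp [A]
    rw [this]
    exact MeasurableSet.iInter fun j => (measurableSet_lt (by fun_prop) (by fun_prop)).inter
      (measurableSet_le (by fun_prop) (by fun_prop))
  have h1 := Measure.prod_apply (μ := μ) (ν := ν) hA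
  have h2 := Measure.prod_apply_symm (μ := μ) (ν := ν) hA
  rw [h1] at h2
  refine Eq.trans (lintegral_congr fun ω => ?_) h2
  have : Prod.mk ω ⁻¹' A =
      Set.univ.pi fun j => Set.Ioc 0 (Real.exp (-Real.exp (β * (X ω j - y j)))) := by
    ext u; simp [A]
  rw [this, hν, Measure.pi_pi, sumExp, ← Finset.sum_neg_distrib, Real.exp_sum,
    ENNReal.ofReal_prod_of_nonneg fun _ _ => (Real.exp_pos _).le]
  refine Finset.prod_congr rfl fun j _ => ?_
  have hlt : Real.exp (-Real.exp (β * (X ω j - y j))) < 1 := by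
    rw [Real.exp_lt_one_iff]
    exact neg_neg_of_pos (Real.exp_pos _)
  rw [Measure.restrict_apply measurableSet_Ioc, Set.inter_eq_left.2, Real.volume_Ioc, sub_zero]
  exact fun u hu => ⟨hu.1, hu.2.trans_lt hlt⟩

/-- An anti-concentration bound for the maximum of a random vector yields one for its soft
maximum. -/
lemma measureReal_sumExp_mem_Icc_le [IsProbabilityMeasure μ] {X : Ω → Fin p → ℝ}
    (hX : Measurable X) {K β : ℝ} (hK : 0 ≤ K) (hβ : 0 < β)
    (h : ∀ (y : Fin p → ℝ) (ε : ℝ), 0 < ε →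
      μ.real {ω | ∀ j, X ω j ≤ y j + ε} ≤ μ.real {ω | ∀ j, X ω j ≤ y j} + K * ε)
    (y : Fin p → ℝ) :
    μ.real {ω | sumExp β y (X ω) ∈ Set.Icc 1 2} ≤
      Real.log 2 / (Real.exp (-1) * (1 - Real.exp (-1 / 2))) * K / β := by
  set κ := Real.exp (-1) * (1 - Real.exp (-1 / 2)) with hκ
  have he : Real.exp (-1 / 2) < 1 := by
    rw [Real.exp_lt_one_iff]
    norm_num
  have hκ0 : 0 < κ := mul_pos (Real.exp_pos _) (by linarith)
  set ε := Real.log 2 / β with hε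
  have hε0 : 0 < ε := div_pos (Real.log_pos one_lt_two) hβ
  set ν := Measure.pi fun _ : Fin p => (volume : Measure ℝ).restrict (Set.Ioo 0 1) with hν
  have : IsProbabilityMeasure ((volume : Measure ℝ).restrict (Set.Ioo 0 1)) := ⟨by simp⟩
  have hνp : IsProbabilityMeasure ν := by rw [hν]; infer_instance
  have hSm : Measurable fun ω => sumExp β y (X ω) := (continuous_sumExp β y).measurable.comp hX
  have hEm : MeasurableSet {ω | sumExp β y (X ω) ∈ Set.Icc 1 2} := hSm measurableSet_Icc
  have key : ∫⁻ ω, ENNReal.ofReal (Real.exp (-sumExp β (fun j => y j + ε) (X ω))) ∂μ ≤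
      ∫⁻ ω, ENNReal.ofReal (Real.exp (-sumExp β y (X ω))) ∂μ + ENNReal.ofReal (K * ε) := by
    rw [lintegral_exp_neg_sumExp hX, lintegral_exp_neg_sumExp hX]
    calc _ ≤ ∫⁻ u, (μ {ω | ∀ j, 0 < u j ∧ u j ≤ Real.exp (-Real.exp (β * (X ω j - y j)))} +
            ENNReal.ofReal (K * ε)) ∂ν := by
          refine lintegral_mono fun u => ?_
          by_cases hu : ∀ j, 0 < u j ∧ u j < 1
          · have hl : ∀ j, 0 < -Real.log (u j) := fun j =>
              neg_pos.2 (Real.log_neg (hu j).1 (hu j).2)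
            have hiff : ∀ y' : Fin p → ℝ,
                {ω | ∀ j, 0 < u j ∧ u j ≤ Real.exp (-Real.exp (β * (X ω j - y' j)))} =
                {ω | ∀ j, X ω j ≤ y' j + Real.log (-Real.log (u j)) / β} := by
              intro y'
              ext ω
              refine forall_congr' fun j => ?_
              rw [and_iff_right (hu j).1, ← Real.log_le_iff_le_exp (hu j).1, le_neg,
                ← Real.le_log_iff_exp_le (hl j), ← sub_le_iff_le_add', le_div_iff₀ hβ, mul_comm]
            rw [hiff, hiff]
            have h1 := h (fun j => y j + Real.log (-Real.log (u j)) / β) ε hε0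
            have h2 : {ω | ∀ j, X ω j ≤ y j + ε + Real.log (-Real.log (u j)) / β} =
                {ω | ∀ j, X ω j ≤ y j + Real.log (-Real.log (u j)) / β + ε} := by
              simp only [add_right_comm]
            rw [h2, ← ofReal_measureReal, ← ofReal_measureReal (μ := μ),
              ← ENNReal.ofReal_add measureReal_nonneg (by positivity)]
            exact ENNReal.ofReal_le_ofReal h1
          · have : {ω | ∀ j, 0 < u j ∧
                u j ≤ Real.exp (-Real.exp (β * (X ω j - (y j + ε))))} = ∅ := by
              refine Set.eq_empty_of_forall_notMem fun ω hω => hu fun j => ⟨(hω j).1, ?_⟩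
              refine (hω j).2.trans_lt ?_
              rw [Real.exp_lt_one_iff]
              exact neg_neg_of_pos (Real.exp_pos _)
            rw [this, measure_empty]
            exact zero_le
      _ = _ := by rw [lintegral_add_right _ measurable_const]; simp [hν]
  have hlow : ∫⁻ ω, ENNReal.ofReal (Real.exp (-sumExp β y (X ω))) ∂μ +
      ENNReal.ofReal κ * μ {ω | sumExp β y (X ω) ∈ Set.Icc 1 2} ≤
      ∫⁻ ω, ENNReal.ofReal (Real.exp (-sumExp β (fun j => y j + ε) (X ω))) ∂μ := by
    rw [← lintegral_indicator_const hEm, ← lintegral_add_left (by fun_prop)]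
    refine lintegral_mono fun ω => ?_
    simp only [hε, sumExp_add_log_two_div hβ]
    set s := sumExp β y (X ω) with hs
    have hs0 : 0 ≤ s := sumExp_nonneg _ _ _
    by_cases hω : ω ∈ {ω | sumExp β y (X ω) ∈ Set.Icc 1 2}
    · rw [Set.indicator_of_mem hω, ← ENNReal.ofReal_add (Real.exp_nonneg _) hκ0.le]
      refine ENNReal.ofReal_le_ofReal ?_
      obtain ⟨h1, h2⟩ : 1 ≤ s ∧ s ≤ 2 := hω
      have e1 : Real.exp (-s) = Real.exp (-(s / 2)) * Real.exp (-(s / 2)) := by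
        rw [← Real.exp_add]; congr 1; ring
      have e2 : Real.exp (-1) ≤ Real.exp (-(s / 2)) := Real.exp_le_exp.2 (by linarith)
      have e3 : Real.exp (-(s / 2)) ≤ Real.exp (-1 / 2) := Real.exp_le_exp.2 (by linarith)
      have := mul_le_mul e2 (sub_le_sub_left e3 1) (by linarith) (Real.exp_nonneg _)
      rw [e1]
      linarith
    · rw [Set.indicator_of_notMem hω, add_zero]
      exact ENNReal.ofReal_le_ofReal (Real.exp_le_exp.2 (by linarith))
  have hfin : ∫⁻ ω, ENNReal.ofReal (Real.exp (-sumExp β y (X ω))) ∂μ ≠ ⊤ := by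
    refine ne_top_of_le_ne_top (b := ∫⁻ _, 1 ∂μ) (by simp) (lintegral_mono fun ω => ?_)
    rw [ENNReal.ofReal_le_one, Real.exp_le_one_iff]
    exact neg_nonpos.2 (sumExp_nonneg _ _ _)
  have h3 := (ENNReal.add_le_add_iff_left hfin).1 (hlow.trans key)
  have h4 := ENNReal.toReal_mono ENNReal.ofReal_ne_top h3
  rw [ENNReal.toReal_mul, ENNReal.toReal_ofReal hκ0.le, ENNReal.toReal_ofReal (by positivity),
    ← measureReal_def] at h4
  rw [div_mul_eq_mul_div, div_div, le_div_iff₀ (by positivity)]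
  calc _ = κ * μ.real {ω | sumExp β y (X ω) ∈ Set.Icc 1 2} * β := by ring
    _ ≤ K * ε * β := by gcongr
    _ = _ := by rw [hε]; field_simp

end SoftMax

lemma exists_smooth_cutoff :
    ∃ (h h₁ h₂ : ℝ → ℝ) (H : ℝ), 0 < H ∧ (∀ s, HasDerivAt h (h₁ s) s) ∧
      (∀ s, HasDerivAt h₁ (h₂ s) s) ∧ Continuous h₂ ∧ (∀ s, 0 ≤ h s) ∧ (∀ s, h s ≤ 1) ∧
      (∀ s ≤ 1, h s = 1) ∧ (∀ s, 2 ≤ s → h s = 0) ∧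
      (∀ s ∉ Set.Icc (1 : ℝ) 2, h₁ s = 0 ∧ h₂ s = 0) ∧ (∀ s, |h₁ s| ≤ H) ∧ ∀ s, |h₂ s| ≤ H := by
  set h : ℝ → ℝ := fun s => 1 - Real.smoothTransition (s - 1) with hh
  have hc : ContDiff ℝ 2 h := by
    have := Real.smoothTransition.contDiff (n := 2)
    fun_prop
  have hc1 : ContDiff ℝ 1 (deriv h) := by
    have : ContDiff ℝ (1 + 1) h := by norm_num; exact hc
    exact (contDiff_succ_iff_deriv.1 this).2.2
  have hc2 : Continuous (deriv (deriv h)) := hc1.continuous_deriv le_rfl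
  have h0 : ∀ s ≤ 1, h s = 1 := fun s hs => by
    simp [hh, Real.smoothTransition.zero_of_nonpos (sub_nonpos.2 hs)]
  have h2 : ∀ s, 2 ≤ s → h s = 0 := fun s hs => by
    simp [hh, Real.smoothTransition.one_of_one_le (by linarith : 1 ≤ s - 1)]
  have hd : ∀ s ∉ Set.Icc (1 : ℝ) 2, deriv h s = 0 := by
    intro s hs
    rw [Set.mem_Icc, not_and_or, not_le, not_le] at hs
    rcases hs with hs | hs
    · rw [Filter.EventuallyEq.deriv_eq (f := fun _ => (1 : ℝ)), deriv_const]
      filter_upwards [Iio_mem_nhds hs] with t ht using h0 t (le_of_lt ht)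
    · rw [Filter.EventuallyEq.deriv_eq (f := fun _ => (0 : ℝ)), deriv_const]
      filter_upwards [Ioi_mem_nhds hs] with t ht using h2 t (le_of_lt ht)
  have hdd : ∀ s ∉ Set.Icc (1 : ℝ) 2, deriv (deriv h) s = 0 := by
    intro s hs
    rw [Filter.EventuallyEq.deriv_eq (f := fun _ => (0 : ℝ)), deriv_const]
    filter_upwards [isClosed_Icc.isOpen_compl.mem_nhds hs] with t ht using hd t ht
  obtain ⟨H₁, hH₁⟩ := isCompact_Icc.exists_bound_of_continuousOn (s := Set.Icc (1 : ℝ) 2)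
    hc1.continuous.continuousOn
  obtain ⟨H₂, hH₂⟩ := isCompact_Icc.exists_bound_of_continuousOn (s := Set.Icc (1 : ℝ) 2)
    hc2.continuousOn
  refine ⟨h, deriv h, deriv (deriv h), |H₁| + |H₂| + 1, by positivity,
    fun s => (hc.differentiable (by norm_num) s).hasDerivAt,
    fun s => (hc1.differentiable (by norm_num) s).hasDerivAt, hc2, fun s => ?_, fun s => ?_, h0, h2,
    fun s hs => ⟨hd s hs, hdd s hs⟩, fun s => ?_, fun s => ?_⟩
  · exact sub_nonneg.2 (Real.smoothTransition.le_one _)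
  · exact sub_le_self _ (Real.smoothTransition.nonneg _)
  · by_cases hs : s ∈ Set.Icc (1 : ℝ) 2
    · have := (hH₁ s hs).trans (le_abs_self _)
      rw [Real.norm_eq_abs] at this
      linarith [abs_nonneg H₂]
    · rw [hd s hs, abs_zero]; positivity
  · by_cases hs : s ∈ Set.Icc (1 : ℝ) 2
    · have := (hH₂ s hs).trans (le_abs_self _)
      rw [Real.norm_eq_abs] at this
      linarith [abs_nonneg H₁]
    · rw [hdd s hs, abs_zero]; positivity

section Interpolation

variable {Ω : Type*} [MeasurableSpace Ω] {μ : Measure Ω} {p : ℕ} {X Y : Ω → Fin p → ℝ}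

lemma hasFDerivAt_exp_mul_sub (β : ℝ) (y z : Fin p → ℝ) (j : Fin p) :
    HasFDerivAt (fun z : Fin p → ℝ => Real.exp (β * (z j - y j)))
      ((β * Real.exp (β * (z j - y j))) •
        ContinuousLinearMap.proj (R := ℝ) (φ := fun _ : Fin p => ℝ) j) z := by
  have h1 : HasFDerivAt (fun z : Fin p → ℝ => z j)
      (ContinuousLinearMap.proj (R := ℝ) (φ := fun _ : Fin p => ℝ) j) z := hasFDerivAt_apply j z
  refine ((h1.sub_const (y j)).const_mul β).exp.congr_fderiv ?_
  rw [smul_smul, mul_comm]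

lemma hasFDerivAt_comp_sumExp {h : ℝ → ℝ} {h' : ℝ} (β : ℝ) (y z : Fin p → ℝ)
    (hh : HasDerivAt h h' (sumExp β y z)) :
    HasFDerivAt (fun z => h (sumExp β y z))
      (∑ k, (β * h' * Real.exp (β * (z k - y k))) •
        ContinuousLinearMap.proj (R := ℝ) (φ := fun _ : Fin p => ℝ) k) z := by
  have h1 : HasFDerivAt (sumExp β y) (∑ k, (β * Real.exp (β * (z k - y k))) •
      ContinuousLinearMap.proj (R := ℝ) (φ := fun _ : Fin p => ℝ) k) z :=
    HasFDerivAt.fun_sum fun k _ => hasFDerivAt_exp_mul_sub β y z k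
  refine (hh.comp_hasFDerivAt z h1).congr_fderiv ?_
  rw [Finset.smul_sum]
  refine Finset.sum_congr rfl fun k _ => ?_
  rw [smul_smul]
  congr 1
  ring

lemma exp_le_sumExp (β : ℝ) (y z : Fin p → ℝ) (j : Fin p) :
    Real.exp (β * (z j - y j)) ≤ sumExp β y z :=
  Finset.single_le_sum (f := fun j => Real.exp (β * (z j - y j)))
    (fun _ _ => (Real.exp_pos _).le) (Finset.mem_univ j)

lemma ProbabilityTheory.HasGaussianLaw.abs_integral_comp_sumExp_sub_le [NeZero p]
    (h : HasGaussianLaw (fun ω => (X ω, Y ω)) μ) (hX : Measurable X) (hY : Measurable Y)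
    (hX0 : ∀ j, μ[fun ω => X ω j] = 0) (hY0 : ∀ j, μ[fun ω => Y ω j] = 0)
    (hXY : ∀ j k, cov[fun ω => X ω j, fun ω => Y ω k; μ] = 0)
    {Δ : ℝ} (hΔ : ∀ j k, |cov[fun ω => X ω j, fun ω => X ω k; μ] -
      cov[fun ω => Y ω j, fun ω => Y ω k; μ]| ≤ Δ)
    {f f₁ f₂ : ℝ → ℝ} {H : ℝ} (hf : ∀ s, HasDerivAt f (f₁ s) s)
    (hf₁ : ∀ s, HasDerivAt f₁ (f₂ s) s) (hf₂ : Continuous f₂) (hf0 : ∀ s, |f s| ≤ 1)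
    (hsupp : ∀ s ∉ Set.Icc (1 : ℝ) 2, f₁ s = 0 ∧ f₂ s = 0)
    (hH₁ : ∀ s, |f₁ s| ≤ H) (hH₂ : ∀ s, |f₂ s| ≤ H)
    {β : ℝ} (hβ : 0 < β) (y : Fin p → ℝ) {Q : ℝ}
    (hQ : ∀ θ : ℝ, μ.real {ω | sumExp β y (Real.sin θ • X ω + Real.cos θ • Y ω) ∈
      Set.Icc 1 2} ≤ Q) :
    |∫ ω, f (sumExp β y (X ω)) ∂μ - ∫ ω, f (sumExp β y (Y ω)) ∂μ| ≤
      2 * (Δ * (6 * H * β ^ 2 * Q)) := by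
  have := h.isProbabilityMeasure
  have hH : 0 ≤ H := (abs_nonneg _).trans (hH₁ 0)
  set w : Fin p → (Fin p → ℝ) → ℝ := fun j z => Real.exp (β * (z j - y j)) with hw
  have hw0 : ∀ j z, 0 < w j z := fun j z => Real.exp_pos _
  have hwc : ∀ j, Continuous (w j) := fun j => by fun_prop
  have hS := continuous_sumExp β y
  have hf₁c : Continuous f₁ := continuous_iff_continuousAt.2 fun s => (hf₁ s).continuousAt
  let m₁ : Fin p → (Fin p → ℝ) → ℝ := fun j z => β * f₁ (sumExp β y z) * w j z
  let m₂ : Fin p → Fin p → (Fin p → ℝ) → ℝ := fun j k z =>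
    β ^ 2 * (f₂ (sumExp β y z) * w j z * w k z + if j = k then f₁ (sumExp β y z) * w j z else 0)
  have hm₂c : ∀ j k, Continuous (m₂ j k) := fun j k => by
    refine continuous_const.mul (((hf₂.comp hS).mul (hwc j)).mul (hwc k) |>.add ?_)
    split_ifs
    · exact (hf₁c.comp hS).mul (hwc j)
    · exact continuous_const
  have hsum : ∀ z, ∑ j, ∑ k, |m₂ j k z| ≤
      6 * H * β ^ 2 * (sumExp β y ⁻¹' Set.Icc 1 2).indicator 1 z := by
    intro z
    by_cases hz : sumExp β y z ∈ Set.Icc 1 2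
    · rw [Set.indicator_of_mem (by exact hz), Pi.one_apply, mul_one]
      set s := sumExp β y z with hs
      have hws : ∑ j, w j z = s := rfl
      calc ∑ j, ∑ k, |m₂ j k z|
          ≤ ∑ j, ∑ k, β ^ 2 * (H * w j z * w k z + if j = k then H * w j z else 0) := by
            refine Finset.sum_le_sum fun j _ => Finset.sum_le_sum fun k _ => ?_
            have hj := (hw0 j z).le
            have hk := (hw0 k z).le
            simp only [m₂]
            rw [abs_mul, abs_of_nonneg (sq_nonneg β)]
            refine mul_le_mul_of_nonneg_left ((abs_add_le _ _).trans (add_le_add ?_ ?_))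
              (sq_nonneg β)
            · rw [abs_mul, abs_mul, abs_of_nonneg hj, abs_of_nonneg hk]
              gcongr
              exact hH₂ _
            · split_ifs
              · rw [abs_mul, abs_of_nonneg hj]
                gcongr
                exact hH₁ _
              · simp
        _ = β ^ 2 * (H * s * s + H * s) := by
            simp only [← Finset.mul_sum, Finset.sum_add_distrib, Finset.sum_ite_eq,
              Finset.mem_univ, if_true, ← Finset.sum_mul, hws]
        _ ≤ β ^ 2 * (H * 2 * 2 + H * 2) := by
            have := hz.2
            have : 0 ≤ s := sumExp_nonneg _ _ _
            gcongr
        _ = _ := by ring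
    · have : ∀ j k, m₂ j k z = 0 := fun j k => by
        simp only [m₂, (hsupp _ hz).1, (hsupp _ hz).2]
        simp
      simp [this, hz]
  have hone : ∀ j k z, |m₂ j k z| ≤ 6 * H * β ^ 2 := by
    intro j k z
    calc |m₂ j k z| ≤ ∑ k, |m₂ j k z| :=
          Finset.single_le_sum (f := fun k => |m₂ j k z|) (fun _ _ => abs_nonneg _)
            (Finset.mem_univ k)
      _ ≤ ∑ j, ∑ k, |m₂ j k z| :=
          Finset.single_le_sum (f := fun j => ∑ k, |m₂ j k z|)
            (fun _ _ => Finset.sum_nonneg fun _ _ => abs_nonneg _) (Finset.mem_univ j)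
      _ ≤ _ := hsum z
      _ ≤ 6 * H * β ^ 2 * 1 := by
          refine mul_le_mul_of_nonneg_left ?_ (by positivity)
          exact Set.indicator_le_self' (fun _ _ => zero_le_one) z
      _ = _ := mul_one _
  refine h.abs_integral_sub_le_of_interpolation hX0 hY0 hXY hΔ (m := fun z => f (sumExp β y z))
    (m₁ := m₁) (m₂ := m₂) (B := 1 + 2 * β * H + 6 * H * β ^ 2)
    (fun z => hasFDerivAt_comp_sumExp β y z (hf _)) (fun j z => ?_) hm₂c (fun z => ?_)
    (fun j z => ?_) (fun j k z => ?_) fun θ => ?_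
  · have h1 := ((hasFDerivAt_comp_sumExp β y z (hf₁ _)).const_mul β).mul
      (hasFDerivAt_exp_mul_sub β y z j)
    refine h1.congr_fderiv ?_
    simp only [m₂, mul_add, add_smul, Finset.sum_add_distrib, Finset.smul_sum, smul_smul, mul_ite,
      mul_zero, ite_smul, zero_smul, Finset.sum_ite_eq, Finset.mem_univ, if_true]
    rw [add_comm]
    congr 1
    · refine Finset.sum_congr rfl fun k _ => ?_
      congr 1
      simp only [hw]
      ring
    · congr 1
      simp only [hw]
      ring
  · have := hf0 (sumExp β y z)
    have : 0 ≤ 2 * β * H + 6 * H * β ^ 2 := by positivity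
    linarith
  · have hb : |m₁ j z| ≤ 2 * β * H := by
      by_cases hz : sumExp β y z ∈ Set.Icc 1 2
      · simp only [m₁]
        rw [abs_mul, abs_mul, abs_of_pos hβ, abs_of_pos (hw0 j z)]
        calc _ ≤ β * H * 2 := by
              gcongr
              · exact hH₁ _
              · exact (exp_le_sumExp β y z j).trans hz.2
          _ = _ := by ring
      · simp only [m₁, (hsupp _ hz).1]
        simp only [mul_zero, zero_mul, abs_zero]
        positivity
    have : 0 ≤ 6 * H * β ^ 2 := by positivity
    linarith
  · have := hone j k z
    have : 0 ≤ 2 * β * H := by positivity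
    linarith
  · set Z : Ω → Fin p → ℝ := fun ω => Real.sin θ • X ω + Real.cos θ • Y ω with hZ
    have hZm : Measurable Z := by fun_prop
    have hint : ∀ j k, Integrable (fun ω => |m₂ j k (Z ω)|) μ := fun j k =>
      Integrable.of_bound ((hm₂c j k).abs.measurable.comp hZm).aestronglyMeasurable
        (6 * H * β ^ 2) (ae_of_all _ fun ω => by simpa using hone j k (Z ω))
    have hE : MeasurableSet (Z ⁻¹' (sumExp β y ⁻¹' Set.Icc 1 2)) :=
      hZm (hS.measurable measurableSet_Icc)
    calc ∑ j, ∑ k, ∫ ω, |m₂ j k (Z ω)| ∂μ = ∫ ω, ∑ j, ∑ k, |m₂ j k (Z ω)| ∂μ := by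
          rw [integral_finsetSum _ fun j _ => integrable_finsetSum _ fun k _ => hint j k]
          exact Finset.sum_congr rfl fun j _ => (integral_finsetSum _ fun k _ => hint j k).symm
      _ ≤ ∫ ω, 6 * H * β ^ 2 * (Z ⁻¹' (sumExp β y ⁻¹' Set.Icc 1 2)).indicator 1 ω ∂μ := by
          refine integral_mono
            (integrable_finsetSum _ fun j _ => integrable_finsetSum _ fun k _ => hint j k)
            (((integrable_const (1 : ℝ)).indicator hE).const_mul _) fun ω => hsum (Z ω)
      _ = 6 * H * β ^ 2 * μ.real (Z ⁻¹' (sumExp β y ⁻¹' Set.Icc 1 2)) := by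
          rw [integral_const_mul, integral_indicator_one hE]
      _ ≤ _ := mul_le_mul_of_nonneg_left (hQ θ) (by positivity)

end Interpolation

section Comparison

variable {Ω : Type*} [MeasurableSpace Ω] {μ : Measure Ω} {p : ℕ} {X Y : Ω → Fin p → ℝ}

lemma ProbabilityTheory.HasGaussianLaw.smul_add_smul (h : HasGaussianLaw (fun ω => (X ω, Y ω)) μ)
    (s t : ℝ) : HasGaussianLaw (fun ω => s • X ω + t • Y ω) μ :=
  h.map_fun (s • ContinuousLinearMap.fst ℝ (Fin p → ℝ) (Fin p → ℝ) +
    t • ContinuousLinearMap.snd ℝ (Fin p → ℝ) (Fin p → ℝ))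

lemma ProbabilityTheory.HasGaussianLaw.swap (h : HasGaussianLaw (fun ω => (X ω, Y ω)) μ) :
    HasGaussianLaw (fun ω => (Y ω, X ω)) μ :=
  h.map_fun ((ContinuousLinearMap.snd ℝ (Fin p → ℝ) (Fin p → ℝ)).prod
    (ContinuousLinearMap.fst ℝ (Fin p → ℝ) (Fin p → ℝ)))

lemma le_variance_sin_add_cos [IsProbabilityMeasure μ] {U V : Ω → ℝ} (hU : MemLp U 2 μ)
    (hV : MemLp V 2 μ) (hUV : cov[U, V; μ] = 0) {c : ℝ} (hcU : c ≤ Var[U; μ])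
    (hcV : c ≤ Var[V; μ]) (θ : ℝ) :
    c ≤ Var[fun ω => Real.sin θ * U ω + Real.cos θ * V ω; μ] := by
  rw [variance_fun_add (hU.const_mul _) (hV.const_mul _), variance_const_mul, variance_const_mul,
    covariance_const_mul_left, covariance_const_mul_right, hUV]
  have h1 := mul_le_mul_of_nonneg_left hcU (sq_nonneg (Real.sin θ))
  have h2 := mul_le_mul_of_nonneg_left hcV (sq_nonneg (Real.cos θ))
  have h3 : c = Real.sin θ ^ 2 * c + Real.cos θ ^ 2 * c := by
    rw [← add_mul, Real.sin_sq_add_cos_sq, one_mul]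
  linarith

lemma sumExp_add_log_div_le_one {β : ℝ} (hβ : 0 < β) (hp : 0 < p) {y z : Fin p → ℝ}
    (hz : ∀ j, z j ≤ y j) : sumExp β (fun j => y j + Real.log p / β) z ≤ 1 := by
  have hp' : (0 : ℝ) < p := by exact_mod_cast hp
  calc sumExp β (fun j => y j + Real.log p / β) z ≤ ∑ _ : Fin p, Real.exp (-Real.log p) := by
        refine Finset.sum_le_sum fun j _ => Real.exp_le_exp.2 ?_
        have h1 : β * (z j - (y j + Real.log p / β)) = β * (z j - y j) - Real.log p := by
          field_simp
          ring
        have := mul_nonpos_of_nonneg_of_nonpos hβ.le (sub_nonpos.2 (hz j))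
        linarith
    _ = 1 := by
        rw [Real.exp_neg, Real.exp_log hp']
        simp [hp'.ne']

lemma le_of_sumExp_lt_two {β : ℝ} (hβ : 0 < β) {y z : Fin p → ℝ} (hz : sumExp β y z < 2)
    (j : Fin p) : z j ≤ y j + Real.log 2 / β := by
  have h1 := (exp_le_sumExp β y z j).trans hz.le
  rw [← Real.le_log_iff_exp_le two_pos] at h1
  rw [← sub_le_iff_le_add', le_div_iff₀ hβ, mul_comm]
  exact h1

/-- Comparison of two jointly Gaussian vectors, with a free smoothing parameter `β`. -/
lemma exists_measureReal_le_add_of_smoothing {c : ℝ} (hc : 0 < c) :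
    ∃ C : ℝ, 0 < C ∧ ∀ {Ω : Type} [MeasurableSpace Ω] {μ : Measure Ω} {p : ℕ}
      {X Y : Ω → Fin p → ℝ}, 2 ≤ p → HasGaussianLaw (fun ω => (X ω, Y ω)) μ →
      Measurable X → Measurable Y → (∀ j, μ[fun ω => X ω j] = 0) → (∀ j, μ[fun ω => Y ω j] = 0) →
      (∀ j k, cov[fun ω => X ω j, fun ω => Y ω k; μ] = 0) →
      (∀ j, c ≤ Var[fun ω => X ω j; μ]) → (∀ j, c ≤ Var[fun ω => Y ω j; μ]) →
      ∀ {Δ : ℝ}, 0 ≤ Δ → (∀ j k, |cov[fun ω => X ω j, fun ω => X ω k; μ] -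
        cov[fun ω => Y ω j, fun ω => Y ω k; μ]| ≤ Δ) →
      ∀ (y : Fin p → ℝ) {β : ℝ}, 0 < β →
      μ.real {ω | ∀ j, X ω j ≤ y j} ≤ μ.real {ω | ∀ j, Y ω j ≤ y j} +
        C * (√(Real.log p) * Real.log p / β + Δ * β * √(Real.log p)) := by
  obtain ⟨f, f₁, f₂, H, hH0, hf, hf₁, hf₂, hf0, hf1, hfone, hfzero, hsupp, hH₁, hH₂⟩ :=
    exists_smooth_cutoff
  set N : ℝ := (1 + Real.exp (5 / 2)) * √2 / √c with hN
  set D : ℝ := Real.log 2 / (Real.exp (-1) * (1 - Real.exp (-1 / 2))) with hD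
  have hN0 : 0 < N := by
    have := Real.sqrt_pos.2 hc
    positivity
  have hD0 : 0 < D := by
    have : Real.exp (-1 / 2) < 1 := by rw [Real.exp_lt_one_iff]; norm_num
    exact div_pos (Real.log_pos one_lt_two) (mul_pos (Real.exp_pos _) (by linarith))
  refine ⟨2 * N + 12 * H * D * N, by positivity, ?_⟩
  intro Ω _ μ p X Y hp h hX hY hX0 hY0 hXY hvX hvY Δ hΔ0 hΔ y β hβ
  have := h.isProbabilityMeasure
  have : NeZero p := ⟨by omega⟩
  have hfc : Continuous f := continuous_iff_continuousAt.2 fun s => (hf s).continuousAt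
  set L := Real.log p with hL
  have hL2 : Real.log 2 ≤ L := Real.log_le_log two_pos (by exact_mod_cast hp)
  have hL0 : 0 < L := (Real.log_pos one_lt_two).trans_le hL2
  have hXm : ∀ j, MemLp (fun ω => X ω j) 2 μ := fun j =>
    (HasGaussianLaw.eval (X := fun i ω => X ω i) h.fst j).memLp_two
  have hYm : ∀ j, MemLp (fun ω => Y ω j) 2 μ := fun j =>
    (HasGaussianLaw.eval (X := fun i ω => Y ω i) h.snd j).memLp_two
  set y' : Fin p → ℝ := fun j => y j + L / β with hy'
  have hQ : ∀ θ : ℝ, μ.real {ω | sumExp β y' (Real.sin θ • X ω + Real.cos θ • Y ω) ∈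
      Set.Icc 1 2} ≤ D * (N * √L) / β := by
    intro θ
    refine measureReal_sumExp_mem_Icc_le (by fun_prop) (by positivity) hβ (fun y ε hε => ?_) y'
    refine (h.smul_add_smul _ _).measureReal_le_add hp (by fun_prop) (fun j => ?_) hc
      (fun j => ?_) y hε
    · simp only [Pi.add_apply, Pi.smul_apply, smul_eq_mul]
      rw [integral_add (((hXm j).integrable (by simp)).const_mul _)
        (((hYm j).integrable (by simp)).const_mul _), integral_const_mul, integral_const_mul,
        hX0, hY0]
      simp
    · exact le_variance_sin_add_cos (hXm j) (hYm j) (hXY j j) (hvX j) (hvY j) θ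
  have hcomp := h.abs_integral_comp_sumExp_sub_le hX hY hX0 hY0 hXY hΔ hf hf₁ hf₂
    (fun s => abs_le.2 ⟨by linarith [hf0 s], hf1 s⟩) hsupp hH₁ hH₂ hβ y' hQ
  have hint : ∀ Z : Ω → Fin p → ℝ, Measurable Z →
      Integrable (fun ω => f (sumExp β y' (Z ω))) μ := fun Z hZ =>
    Integrable.of_bound ((hfc.comp (continuous_sumExp β y')).measurable.comp hZ).aestronglyMeasurable
      1 (ae_of_all _ fun ω => by
        rw [Real.norm_of_nonneg (hf0 _)]
        exact hf1 _)
  have hmeas : ∀ (Z : Ω → Fin p → ℝ) (t : Fin p → ℝ), Measurable Z →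
      MeasurableSet {ω | ∀ j, Z ω j ≤ t j} := fun Z t hZ =>
    hZ (measurableSet_Iic (a := t))
  have hlow : μ.real {ω | ∀ j, X ω j ≤ y j} ≤ ∫ ω, f (sumExp β y' (X ω)) ∂μ := by
    rw [← integral_indicator_one (hmeas X y hX)]
    refine integral_mono ((integrable_const (1 : ℝ)).indicator (hmeas X y hX)) (hint X hX) fun ω => ?_
    by_cases hω : ω ∈ {ω | ∀ j, X ω j ≤ y j}
    · have := hfone _ (sumExp_add_log_div_le_one hβ (by omega) hω)
      rw [Set.indicator_of_mem hω]
      exact this.ge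
    · rw [Set.indicator_of_notMem hω]
      exact hf0 _
  have hup : ∫ ω, f (sumExp β y' (Y ω)) ∂μ ≤
      μ.real {ω | ∀ j, Y ω j ≤ y j + 2 * L / β} := by
    have hm := hmeas Y (fun j => y j + 2 * L / β) hY
    rw [← integral_indicator_one hm]
    refine integral_mono (hint Y hY) ((integrable_const (1 : ℝ)).indicator hm) fun ω => ?_
    by_cases hω : sumExp β y' (Y ω) < 2
    · have : ω ∈ {ω | ∀ j, Y ω j ≤ y j + 2 * L / β} := fun j => by
        refine (le_of_sumExp_lt_two hβ hω j).trans ?_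
        simp only [hy']
        have : Real.log 2 / β ≤ L / β := by gcongr
        have e : 2 * L / β = L / β + L / β := by ring
        linarith
      simp only [Set.indicator_of_mem this]
      exact hf1 _
    · simp only [hfzero _ (not_lt.1 hω)]
      exact Set.indicator_nonneg (fun _ _ => zero_le_one) _
  have hnaz := h.snd.measureReal_le_add hp hY hY0 hc hvY y (ε := 2 * L / β) (by positivity)
  rw [← hN, ← hL] at hnaz
  have h1 := (abs_le.1 hcomp).2
  calc _ ≤ μ.real {ω | ∀ j, Y ω j ≤ y j} + N * √L * (2 * L / β) +
          2 * (Δ * (6 * H * β ^ 2 * (D * (N * √L) / β))) := by linarith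
    _ = μ.real {ω | ∀ j, Y ω j ≤ y j} + (2 * N * (√L * L / β) +
          12 * H * D * N * (Δ * β * √L)) := by
        field_simp
        ring
    _ ≤ _ := by
        have t1 : 0 ≤ √L * L / β := by positivity
        have t2 : 0 ≤ Δ * β * √L := by positivity
        have t3 : 0 ≤ 12 * H * D * N := by positivity
        have t4 := mul_nonneg t3 t1
        have t5 := mul_nonneg hN0.le t2
        linarith

/-- Comparison of two independent Gaussian vectors whose variances are bounded below. -/
lemma exists_abs_measureReal_sub_le {c : ℝ} (hc : 0 < c) :
    ∃ C : ℝ, 0 < C ∧ ∀ {Ω : Type} [MeasurableSpace Ω] {μ : Measure Ω} {p : ℕ}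
      {X Y : Ω → Fin p → ℝ}, 2 ≤ p → HasGaussianLaw (fun ω => (X ω, Y ω)) μ →
      Measurable X → Measurable Y → (∀ j, μ[fun ω => X ω j] = 0) → (∀ j, μ[fun ω => Y ω j] = 0) →
      (∀ j k, cov[fun ω => X ω j, fun ω => Y ω k; μ] = 0) →
      (∀ j, c ≤ Var[fun ω => X ω j; μ]) → (∀ j, c ≤ Var[fun ω => Y ω j; μ]) →
      ∀ {Δ : ℝ}, 0 ≤ Δ → (∀ j k, |cov[fun ω => X ω j, fun ω => X ω k; μ] -
        cov[fun ω => Y ω j, fun ω => Y ω k; μ]| ≤ Δ) →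
      ∀ y : Fin p → ℝ,
      |μ.real {ω | ∀ j, X ω j ≤ y j} - μ.real {ω | ∀ j, Y ω j ≤ y j}| ≤
        C * (√Δ * Real.log p) := by
  obtain ⟨C, hC0, hC⟩ := exists_measureReal_le_add_of_smoothing hc
  refine ⟨2 * C, by positivity, ?_⟩
  intro Ω _ μ p X Y hp h hX hY hX0 hY0 hXY hvX hvY Δ hΔ0 hΔ y
  have hL0 : 0 < Real.log p := Real.log_pos (by exact_mod_cast hp)
  have pos : ∀ {δ : ℝ}, 0 < δ → Δ ≤ δ →
      |μ.real {ω | ∀ j, X ω j ≤ y j} - μ.real {ω | ∀ j, Y ω j ≤ y j}| ≤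
        2 * C * (√δ * Real.log p) := by
    intro δ hδ hΔδ
    have hδ' : ∀ j k, |cov[fun ω => X ω j, fun ω => X ω k; μ] -
        cov[fun ω => Y ω j, fun ω => Y ω k; μ]| ≤ δ := fun j k => (hΔ j k).trans hΔδ
    have hs : 0 < √δ := Real.sqrt_pos.2 hδ
    have hsL : 0 < √(Real.log p) := Real.sqrt_pos.2 hL0
    have hβ : 0 < √(Real.log p) / √δ := by positivity
    have e : C * (√(Real.log p) * Real.log p / (√(Real.log p) / √δ) +
        δ * (√(Real.log p) / √δ) * √(Real.log p)) = 2 * C * (√δ * Real.log p) := by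
      have e1 : √(Real.log p) * Real.log p / (√(Real.log p) / √δ) = √δ * Real.log p := by
        field_simp
      have e2 : δ * (√(Real.log p) / √δ) * √(Real.log p) = √δ * Real.log p := by
        calc _ = (δ / √δ) * (√(Real.log p) * √(Real.log p)) := by ring
          _ = _ := by rw [Real.div_sqrt, Real.mul_self_sqrt hL0.le]
      rw [e1, e2]
      ring
    have h1 := hC hp h hX hY hX0 hY0 hXY hvX hvY hδ.le hδ' y hβ
    have h2 := hC hp h.swap hY hX hY0 hX0 (fun j k => by rw [covariance_comm]; exact hXY k j)
      hvY hvX hδ.le (fun j k => by rw [abs_sub_comm]; exact hδ' j k) y hβ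
    rw [e] at h1 h2
    exact abs_le.2 ⟨by linarith, by linarith⟩
  rcases hΔ0.eq_or_lt with rfl | hΔp
  · refine le_of_forall_pos_le_add fun ε hε => ?_
    have hpos : 0 < 2 * C * Real.log p := by positivity
    refine (pos (δ := (ε / (2 * C * Real.log p)) ^ 2) (by positivity) (by positivity)).trans ?_
    rw [Real.sqrt_sq (by positivity), Real.sqrt_zero, zero_mul, mul_zero, zero_add]
    apply le_of_eq
    field_simp
  · exact pos hΔp le_rfl

end Comparison

section Reduction

variable {Ω : Type} [MeasurableSpace Ω] {μ : Measure Ω} {p : ℕ} {Z : Ω → Fin p → ℝ}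
  {S : Fin p → Fin p → ℝ}

lemma IsCenteredGaussianVec.hasLaw (h : IsCenteredGaussianVec μ Z S) (hZ : Measurable Z)
    (u : Fin p → ℝ) : HasLaw (fun ω => ∑ j, u j * Z ω j)
      (gaussianReal 0 (Real.toNNReal (∑ j, ∑ k, u j * S j k * u k))) μ :=
  ⟨by fun_prop, h u⟩

lemma IsCenteredGaussianVec.hasGaussianLaw (h : IsCenteredGaussianVec μ Z S)
    (hZ : Measurable Z) : HasGaussianLaw Z μ := by
  refine ⟨isGaussian_of_map_eq_gaussianReal fun L => ?_⟩
  rw [Measure.map_map (by fun_prop) hZ]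
  have : L ∘ Z = fun ω => ∑ j, L (Pi.single j 1) * Z ω j := by
    ext ω
    simp only [Function.comp_apply]
    conv_lhs => rw [← Finset.univ_sum_single (Z ω), map_sum]
    refine Finset.sum_congr rfl fun j _ => ?_
    have : (Pi.single j (Z ω j) : Fin p → ℝ) = Z ω j • Pi.single j 1 := by
      rw [← Pi.single_smul, smul_eq_mul, mul_one]
    rw [this, map_smul, smul_eq_mul, mul_comm]
  exact ⟨_, _, by rw [this]; exact h fun j => L (Pi.single j 1)⟩

lemma IsCenteredGaussianVec.variance_eq (h : IsCenteredGaussianVec μ Z S) (hZ : Measurable Z)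
    (u : Fin p → ℝ) :
    Var[fun ω => ∑ j, u j * Z ω j; μ] = max (∑ j, ∑ k, u j * S j k * u k) 0 := by
  rw [(h.hasLaw hZ u).variance_eq, variance_id_gaussianReal, Real.coe_toNNReal']

lemma IsCenteredGaussianVec.integral_eq_zero (h : IsCenteredGaussianVec μ Z S)
    (hZ : Measurable Z) (j : Fin p) : μ[fun ω => Z ω j] = 0 := by
  have := (h.hasLaw hZ (Pi.single j 1)).integral_eq
  simpa [Pi.single_apply] using this

lemma IsCenteredGaussianVec.variance_eval (h : IsCenteredGaussianVec μ Z S) (hZ : Measurable Z)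
    (j : Fin p) : Var[fun ω => Z ω j; μ] = max (S j j) 0 := by
  have := h.variance_eq hZ (Pi.single j 1)
  simpa [Pi.single_apply] using this

/-- The matrix `S` need not be symmetric, and only its symmetric part is a covariance matrix. -/
lemma IsCenteredGaussianVec.covariance_eval (h : IsCenteredGaussianVec μ Z S) (hZ : Measurable Z)
    (hS : ∀ j, 0 ≤ S j j) (j k : Fin p) :
    cov[fun ω => Z ω j, fun ω => Z ω k; μ] = (S j k + S k j) / 2 := by
  have hG := h.hasGaussianLaw hZ
  have := hG.isProbabilityMeasure
  have hm : ∀ i, MemLp (fun ω => Z ω i) 2 μ := fun i =>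
    (HasGaussianLaw.eval (X := fun i ω => Z ω i) hG i).memLp_two
  have hadd := h.variance_eq hZ (Pi.single j 1 + Pi.single k 1)
  have hsub := h.variance_eq hZ (Pi.single j 1 - Pi.single k 1)
  simp only [Pi.add_apply, Pi.sub_apply, Pi.single_apply, add_mul, sub_mul, mul_add, mul_sub,
    Finset.sum_add_distrib, Finset.sum_sub_distrib, ite_mul, mul_ite, one_mul, zero_mul, mul_one,
    mul_zero, Finset.sum_ite_eq', Finset.mem_univ, if_true] at hadd hsub
  rw [variance_fun_add (hm j) (hm k), h.variance_eval hZ, h.variance_eval hZ,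
    max_eq_left (hS j), max_eq_left (hS k)] at hadd
  rw [variance_fun_sub (hm j) (hm k), h.variance_eval hZ, h.variance_eval hZ,
    max_eq_left (hS j), max_eq_left (hS k)] at hsub
  have h1 := le_max_left (S j j + S k j + (S j k + S k k)) 0
  have h2 := le_max_left (S j j - S k j - (S j k - S k k)) 0
  linarith

end Reduction

/-- **Gaussian-to-Gaussian comparison** (Corollary 5.1). If `Z₁, Z₂` are centered
Gaussian vectors in `ℝ^p` with covariance matrices `S₁, S₂` and `S₂` has diagonal
bounded below by `c > 0`, then `sup_y |P(Z₁ ≤ y) − P(Z₂ ≤ y)| ≤ C (Δ log² p)^{1/2}`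
with `Δ = max_{j,k} |S₁_{jk} − S₂_{jk}|` and `C` depending only on `c`. -/
theorem gaussian_to_gaussian_comparison (c : ℝ) (hc : 0 < c) :
    ∃ C : ℝ, 0 < C ∧
      ∀ (p : ℕ), 2 ≤ p →
      ∀ (S₁ S₂ : Fin p → Fin p → ℝ), (∀ j, c ≤ S₂ j j) →
      ∀ (Ω₁ : Type) (_ : MeasurableSpace Ω₁) (P₁ : Measure Ω₁) (_ : IsProbabilityMeasure P₁)
        (Z₁ : Ω₁ → Fin p → ℝ), Measurable Z₁ → IsCenteredGaussianVec P₁ Z₁ S₁ →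
      ∀ (Ω₂ : Type) (_ : MeasurableSpace Ω₂) (P₂ : Measure Ω₂) (_ : IsProbabilityMeasure P₂)
        (Z₂ : Ω₂ → Fin p → ℝ), Measurable Z₂ → IsCenteredGaussianVec P₂ Z₂ S₂ →
      ∀ y : Fin p → ℝ,
        |(P₁ {ω | ∀ j, Z₁ ω j ≤ y j}).toReal - (P₂ {ω | ∀ j, Z₂ ω j ≤ y j}).toReal| ≤
          C * ((⨆ j, ⨆ k, |S₁ j k - S₂ j k|) * Real.log p ^ 2) ^ ((1 : ℝ) / 2) := by
  obtain ⟨C, hC0, hC⟩ := exists_abs_measureReal_sub_le (half_pos hc)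
  have hl2 : 0 < Real.log 2 := Real.log_pos one_lt_two
  have hc2 : 0 < √(c / 2) := Real.sqrt_pos.2 (half_pos hc)
  refine ⟨C + 1 / (√(c / 2) * Real.log 2), by positivity, ?_⟩
  intro p hp S₁ S₂ hS₂ Ω₁ _ P₁ _ Z₁ hZ₁ hG₁ Ω₂ _ P₂ _ Z₂ hZ₂ hG₂ y
  set Δ : ℝ := ⨆ j, ⨆ k, |S₁ j k - S₂ j k| with hΔ
  have hle : ∀ j k, |S₁ j k - S₂ j k| ≤ Δ := fun j k =>
    (le_ciSup (f := fun k => |S₁ j k - S₂ j k|) (Finite.bddAbove_range _) k).trans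
      (le_ciSup (f := fun j => ⨆ k, |S₁ j k - S₂ j k|) (Finite.bddAbove_range _) j)
  have hΔ0 : 0 ≤ Δ := (abs_nonneg _).trans (hle ⟨0, by omega⟩ ⟨0, by omega⟩)
  have hlog : Real.log 2 ≤ Real.log p := Real.log_le_log two_pos (by exact_mod_cast hp)
  have hL0 : 0 < Real.log p := hl2.trans_le hlog
  rw [← Real.sqrt_eq_rpow, Real.sqrt_mul hΔ0, Real.sqrt_sq hL0.le, add_mul]
  simp only [← measureReal_def]
  rcases le_or_gt (c / 2) Δ with hcΔ | hcΔ
  · have h1 : 1 ≤ 1 / (√(c / 2) * Real.log 2) * (√Δ * Real.log p) := by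
      rw [one_div_mul_eq_div, one_le_div (by positivity)]
      gcongr
    have h2 : |P₁.real {ω | ∀ j, Z₁ ω j ≤ y j} - P₂.real {ω | ∀ j, Z₂ ω j ≤ y j}| ≤ 1 := by
      rw [abs_le]
      constructor <;>
      linarith [measureReal_le_one (μ := P₁) (s := {ω | ∀ j, Z₁ ω j ≤ y j}),
        measureReal_le_one (μ := P₂) (s := {ω | ∀ j, Z₂ ω j ≤ y j}),
        measureReal_nonneg (μ := P₁) (s := {ω | ∀ j, Z₁ ω j ≤ y j}),
        measureReal_nonneg (μ := P₂) (s := {ω | ∀ j, Z₂ ω j ≤ y j})]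
    have : 0 ≤ C * (√Δ * Real.log p) := by positivity
    linarith
  · have hS₁ : ∀ j, c / 2 ≤ S₁ j j := fun j => by
      linarith [(abs_le.1 (hle j j)).1, hS₂ j]
    have hcS₂ : ∀ j, c / 2 ≤ S₂ j j := fun j => by linarith [hS₂ j]
    have hS₁0 : ∀ j, 0 ≤ S₁ j j := fun j => by linarith [hS₁ j]
    have hS₂0 : ∀ j, 0 ≤ S₂ j j := fun j => by linarith [hS₂ j]
    have mp₁ : MeasurePreserving Prod.fst (P₁.prod P₂) P₁ := measurePreserving_fst
    have mp₂ : MeasurePreserving Prod.snd (P₁.prod P₂) P₂ := measurePreserving_snd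
    have hX : IsCenteredGaussianVec (P₁.prod P₂) (fun q => Z₁ q.1) S₁ := fun u => by
      rw [← hG₁ u, ← mp₁.map_eq, Measure.map_map (by fun_prop) (by fun_prop), mp₁.map_eq]
      rfl
    have hY : IsCenteredGaussianVec (P₁.prod P₂) (fun q => Z₂ q.2) S₂ := fun u => by
      rw [← hG₂ u, ← mp₂.map_eq, Measure.map_map (by fun_prop) (by fun_prop), mp₂.map_eq]
      rfl
    have hXm : Measurable fun q : Ω₁ × Ω₂ => Z₁ q.1 := by fun_prop
    have hYm : Measurable fun q : Ω₁ × Ω₂ => Z₂ q.2 := by fun_prop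
    have hXG := hX.hasGaussianLaw hXm
    have hYG := hY.hasGaussianLaw hYm
    have hind : IndepFun (fun q : Ω₁ × Ω₂ => Z₁ q.1) (fun q => Z₂ q.2) (P₁.prod P₂) :=
      indepFun_prod hZ₁ hZ₂
    have hcov : ∀ j k, |cov[fun q : Ω₁ × Ω₂ => Z₁ q.1 j, fun q => Z₁ q.1 k; P₁.prod P₂] -
        cov[fun q : Ω₁ × Ω₂ => Z₂ q.2 j, fun q => Z₂ q.2 k; P₁.prod P₂]| ≤ Δ := fun j k => by
      rw [hX.covariance_eval hXm hS₁0, hY.covariance_eval hYm hS₂0, abs_le]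
      have h1 := abs_le.1 (hle j k)
      have h2 := abs_le.1 (hle k j)
      constructor <;> linarith
    have key := hC hp (hind.hasGaussianLaw hXG hYG) hXm hYm (hX.integral_eq_zero hXm)
      (hY.integral_eq_zero hYm)
      (fun j k => (hind.comp (measurable_pi_apply j) (measurable_pi_apply k)).covariance_eq_zero
        (HasGaussianLaw.eval (X := fun i (q : Ω₁ × Ω₂) => Z₁ q.1 i) hXG j).memLp_two
        (HasGaussianLaw.eval (X := fun i (q : Ω₁ × Ω₂) => Z₂ q.2 i) hYG k).memLp_two)
      (fun j => by
        rw [hX.variance_eval hXm]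
        exact (hS₁ j).trans (le_max_left _ _))
      (fun j => by
        rw [hY.variance_eval hYm]
        exact (hcS₂ j).trans (le_max_left _ _)) hΔ0 hcov y
    have e₁ : (P₁.prod P₂).real {q | ∀ j, Z₁ q.1 j ≤ y j} = P₁.real {ω | ∀ j, Z₁ ω j ≤ y j} :=
      mp₁.measureReal_preimage (hZ₁ (measurableSet_Iic (a := y))).nullMeasurableSet
    have e₂ : (P₁.prod P₂).real {q | ∀ j, Z₂ q.2 j ≤ y j} = P₂.real {ω | ∀ j, Z₂ ω j ≤ y j} :=
      mp₂.measureReal_preimage (hZ₂ (measurableSet_Iic (a := y))).nullMeasurableSet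
    rw [e₁, e₂] at key
    have : 0 ≤ 1 / (√(c / 2) * Real.log 2) * (√Δ * Real.log p) := by positivity
    linarith
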